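/- There exist three positive absolute constants C1, C2, C3 with the following property: for every dimension d ∈ ℕ and every finite set Q ⊂ ℤ^d there exists a number m ≤ C1·|Q| and points ξ^1, …, ξ^m in the torus 𝕋^d such that for every trigonometric polynomial f ∈ T(Q) one has C2·‖f‖_2^2 ≤ (1/m)·∑_{j=1}^m |f(ξ^j)|^2 ≤ C3·‖f‖_2^2. -/

import Mathlib

noncomputable section
open MeasureTheory

/-- The fundamental cell `[0, 2π)^d` of the torus `𝕋^d`. -/
def torusCell (d : ℕ) : Set (Fin d → ℝ) := Set.univ.pi fun _ => Set.Ico 0 (2 * Real.pi)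

/-- Normalized Lebesgue (probability) measure on the torus `𝕋^d = [0,2π)^d`. -/
def torusMeasure (d : ℕ) : Measure (Fin d → ℝ) :=
  (ENNReal.ofReal ((2 * Real.pi) ^ d))⁻¹ • (volume.restrict (torusCell d))

/-- The `L_q` norm on the torus with respect to the normalized Lebesgue measure. -/
def torusLq (d : ℕ) (q : ℝ) {E : Type*} [NormedAddCommGroup E] (f : (Fin d → ℝ) → E) : ℝ :=
  (∫ x, ‖f x‖ ^ q ∂(torusMeasure d)) ^ (1 / q)

namespace KS
open Matrix
variable {n : Type*} [Fintype n] [DecidableEq n]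

def rk (u : n → ℂ) : Matrix n n ℂ := vecMulVec u (star u)

theorem det_affine (Y : Matrix n n ℂ) (u v : n → ℂ) (s : ℂ) :
    (Y + s • vecMulVec u v).det =
      Y.det + s * ((Y + vecMulVec u v).det - Y.det) := by
  have key : ∀ t : ℂ, (Y + t • vecMulVec u v).det =
      t * (updateCol (fromBlocks Y (0 : Matrix n Unit ℂ) (replicateRow Unit v) 1) (Sum.inr ())
        (Sum.elim (-u) 0)).det +
      (updateCol (fromBlocks Y (0 : Matrix n Unit ℂ) (replicateRow Unit v) 1) (Sum.inr ())
        (Sum.elim 0 1)).det := by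
    intro t
    rw [← det_updateCol_smul, ← det_updateCol_add]
    have h1 : (updateCol (fromBlocks Y (0 : Matrix n Unit ℂ) (replicateRow Unit v) 1) (Sum.inr ())
        (t • Sum.elim (-u) (0 : Unit → ℂ) + Sum.elim (0 : n → ℂ) (1 : Unit → ℂ))) =
        fromBlocks Y (replicateCol Unit (-(t • u))) (replicateRow Unit v) 1 := by
      ext i j
      rcases i with i | i <;> rcases j with j | j <;> simp [updateCol_apply, fromBlocks]
    rw [h1, det_fromBlocks_one₂₂]
    congr 1
    ext i j
    simp [vecMulVec_apply, Matrix.mul_apply, mul_assoc]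
  have h0 := key 0
  have h1 := key 1
  rw [key s]
  simp only [zero_smul, add_zero, zero_mul, zero_add, one_smul, one_mul] at h0 h1
  rw [h1, h0]; ring

def H : List (n → ℂ) → Matrix n n ℂ → Matrix n n ℂ → ℂ
  | [], Y1, Y2 => Y1.det * Y2.det
  | u :: l, Y1, Y2 => (H l (Y1 - rk u) (Y2 + rk u) + H l (Y1 + rk u) (Y2 - rk u)) / 2

theorem H_affine1 (l : List (n → ℂ)) (Y1 Y2 : Matrix n n ℂ) (u : n → ℂ) (s : ℂ) :
    H l (Y1 + s • rk u) Y2 = H l Y1 Y2 + s * (H l (Y1 + rk u) Y2 - H l Y1 Y2) := by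
  induction l generalizing Y1 Y2 with
  | nil => simp only [H, rk]; rw [det_affine]; ring
  | cons w l ih =>
    simp only [H]
    rw [show Y1 + s • rk u - rk w = Y1 - rk w + s • rk u by abel,
      show Y1 + s • rk u + rk w = Y1 + rk w + s • rk u by abel,
      show Y1 + rk u - rk w = Y1 - rk w + rk u by abel,
      show Y1 + rk u + rk w = Y1 + rk w + rk u by abel, ih, ih]
    ring

theorem H_affine2 (l : List (n → ℂ)) (Y1 Y2 : Matrix n n ℂ) (u : n → ℂ) (s : ℂ) :
    H l Y1 (Y2 + s • rk u) = H l Y1 Y2 + s * (H l Y1 (Y2 + rk u) - H l Y1 Y2) := by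
  induction l generalizing Y1 Y2 with
  | nil => simp only [H, rk]; rw [det_affine]; ring
  | cons w l ih =>
    simp only [H]
    rw [show Y2 + s • rk u - rk w = Y2 - rk w + s • rk u by abel,
      show Y2 + s • rk u + rk w = Y2 + rk w + s • rk u by abel,
      show Y2 + rk u - rk w = Y2 - rk w + rk u by abel,
      show Y2 + rk u + rk w = Y2 + rk w + rk u by abel, ih, ih]
    ring

/-- bi-affine expansion -/
theorem H_biaffine (l : List (n → ℂ)) (Y1 Y2 : Matrix n n ℂ) (u : n → ℂ) (s t : ℂ) :
    H l (Y1 + s • rk u) (Y2 + t • rk u) = H l Y1 Y2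
      + (H l (Y1 + rk u) Y2 - H l Y1 Y2) * s + (H l Y1 (Y2 + rk u) - H l Y1 Y2) * t
      + (H l (Y1 + rk u) (Y2 + rk u) - H l (Y1 + rk u) Y2 - H l Y1 (Y2 + rk u) + H l Y1 Y2)
        * s * t := by
  rw [H_affine1, H_affine2, H_affine2]; ring

/-- numerical range in the open upper half plane -/
def UH (Y : Matrix n n ℂ) : Prop := ∀ w : n → ℂ, w ≠ 0 → 0 < (star w ⬝ᵥ Y *ᵥ w).im

theorem quad_rk (u w : n → ℂ) :
    star w ⬝ᵥ rk u *ᵥ w = ((‖star u ⬝ᵥ w‖ ^ 2 : ℝ) : ℂ) := by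
  rw [rk, vecMulVec_mulVec, dotProduct_smul]
  have : star w ⬝ᵥ u = star (star u ⬝ᵥ w) := star_dotProduct w u
  rw [this]
  simp [← Complex.conj_mul']
  
theorem UH.add_rk {Y : Matrix n n ℂ} (h : UH Y) (u : n → ℂ) {s : ℂ} (hs : 0 ≤ s.im) :
    UH (Y + s • rk u) := by
  intro w hw
  rw [add_mulVec, dotProduct_add, smul_mulVec, dotProduct_smul, quad_rk]
  have := h w hw
  rw [Complex.add_im, smul_eq_mul, Complex.mul_im, Complex.ofReal_re, Complex.ofReal_im]
  have : 0 ≤ s.im * ‖star u ⬝ᵥ w‖ ^ 2 := by positivity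
  linarith

theorem UH.det_ne {Y : Matrix n n ℂ} (h : UH Y) : Y.det ≠ 0 := by
  intro h0
  obtain ⟨w, hw, hw0⟩ := exists_mulVec_eq_zero_iff.mpr h0
  have := h w hw
  simp [hw0] at this

theorem biaffine_ne (α β γ κ : ℂ)
    (h : ∀ s t : ℂ, 0 ≤ s.im → 0 ≤ t.im → α + β * s + γ * t + κ * s * t ≠ 0)
    (μ : ℝ) (h1 : -1 ≤ μ) (h2 : μ ≤ 1) : α - κ + μ * (γ - β) ≠ 0 := by
  intro h0
  set b0 := α + β + γ + κ with hb0
  set b2 := ((1 - μ ^ 2 : ℝ) : ℂ) * κ with hb2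
  have hg : ∀ z : ℂ, 0 ≤ z.im → b0 * (1 + z) + b2 * z ^ 2 ≠ 0 := by
    intro z hz
    have := h (1 + ((1 + μ : ℝ) : ℂ) * z) (1 + ((1 - μ : ℝ) : ℂ) * z)
      (by rw [Complex.add_im, Complex.im_ofReal_mul]; simp; apply mul_nonneg <;> linarith)
      (by rw [Complex.add_im, Complex.im_ofReal_mul]; simp; apply mul_nonneg <;> linarith)
    intro h3
    apply this
    rw [← h3, hb0, hb2]
    push_cast
    linear_combination (-z) * h0
  have hb0' : b0 ≠ 0 := by simpa using hg 0 (by simp)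
  by_cases hb : b2 = 0
  · exact hg (-1) (by simp) (by rw [hb]; ring)
  obtain ⟨r, hr⟩ := IsAlgClosed.exists_pow_nat_eq (1 - 4 * (b2 / b0)) (n := 2) (by norm_num)
  have main : ∀ s : ℂ, s ^ 2 + s + b2 / b0 = 0 → s.im ≤ 0 → False := by
    intro s hs him
    have hs0 : s ≠ 0 := by
      rintro rfl
      simp [hb, hb0'] at hs
    apply hg s⁻¹
    · rw [Complex.inv_im]
      apply div_nonneg (by linarith) (Complex.normSq_nonneg s)
    · field_simp at hs ⊢
      linear_combination hs
  rcases le_total r.im 0 with hr0 | hr0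
  · apply main ((-1 + r) / 2)
    · linear_combination hr / 4
    · have : ((-1 + r) / 2).im = r.im / 2 := by simp
      rw [this]; linarith
  · apply main ((-1 - r) / 2)
    · linear_combination hr / 4
    · have : ((-1 - r) / 2).im = - r.im / 2 := by simp
      rw [this]; linarith

theorem H_cons_biased_eq (l : List (n → ℂ)) (u : n → ℂ) (Y1 Y2 : Matrix n n ℂ) (t : ℝ) :
    (t : ℂ) * H l (Y1 - rk u) (Y2 + rk u) + ((1 - t : ℝ) : ℂ) * H l (Y1 + rk u) (Y2 - rk u) =
      H l Y1 Y2 - (H l (Y1 + rk u) (Y2 + rk u) - H l (Y1 + rk u) Y2 - H l Y1 (Y2 + rk u)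
        + H l Y1 Y2) + ((2 * t - 1 : ℝ) : ℂ) * ((H l Y1 (Y2 + rk u) - H l Y1 Y2)
        - (H l (Y1 + rk u) Y2 - H l Y1 Y2)) := by
  have e1 := H_biaffine l Y1 Y2 u (-1) 1
  have e2 := H_biaffine l Y1 Y2 u 1 (-1)
  simp only [neg_smul, one_smul, ← sub_eq_add_neg] at e1 e2
  rw [e1, e2]
  push_cast
  ring

theorem H_stable (l : List (n → ℂ)) (Y1 Y2 : Matrix n n ℂ) (h1 : UH Y1) (h2 : UH Y2) :
    H l Y1 Y2 ≠ 0 := by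
  induction l generalizing Y1 Y2 with
  | nil => exact mul_ne_zero h1.det_ne h2.det_ne
  | cons u l ih =>
    have := biaffine_ne (H l Y1 Y2) (H l (Y1 + rk u) Y2 - H l Y1 Y2)
      (H l Y1 (Y2 + rk u) - H l Y1 Y2)
      (H l (Y1 + rk u) (Y2 + rk u) - H l (Y1 + rk u) Y2 - H l Y1 (Y2 + rk u) + H l Y1 Y2)
      (fun s t hs ht => by
        rw [← H_biaffine]; exact ih _ _ (h1.add_rk u hs) (h2.add_rk u ht)) (2 * (1/2) - 1)
        (by norm_num) (by norm_num)
    rw [← H_cons_biased_eq] at this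
    intro h
    apply this
    rw [← h, H]
    push_cast
    ring

theorem H_stable_biased (l : List (n → ℂ)) (u : n → ℂ) (Y1 Y2 : Matrix n n ℂ) (h1 : UH Y1)
    (h2 : UH Y2) (t : ℝ) (ht0 : 0 ≤ t) (ht1 : t ≤ 1) :
    (t : ℂ) * H l (Y1 - rk u) (Y2 + rk u) + ((1 - t : ℝ) : ℂ) * H l (Y1 + rk u) (Y2 - rk u) ≠ 0 := by
  rw [H_cons_biased_eq]
  exact biaffine_ne (H l Y1 Y2) (H l (Y1 + rk u) Y2 - H l Y1 Y2)
      (H l Y1 (Y2 + rk u) - H l Y1 Y2)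
      (H l (Y1 + rk u) (Y2 + rk u) - H l (Y1 + rk u) Y2 - H l Y1 (Y2 + rk u) + H l Y1 Y2)
      (fun s t hs ht => by
        rw [← H_biaffine]; exact H_stable l _ _ (h1.add_rk u hs) (h2.add_rk u ht)) (2 * t - 1)
        (by linarith) (by linarith)

theorem rk_herm (u : n → ℂ) : (rk u)ᴴ = rk u := by
  rw [rk, conjTranspose_vecMulVec, star_star]

theorem H_star (l : List (n → ℂ)) (Y1 Y2 : Matrix n n ℂ) :
    star (H l Y1 Y2) = H l Y1ᴴ Y2ᴴ := by
  induction l generalizing Y1 Y2 with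
  | nil => simp [H, det_conjTranspose]
  | cons u l ih =>
    simp only [H, star_div₀, star_add, ih, conjTranspose_sub, conjTranspose_add, rk_herm]
    simp

theorem H_real (l : List (n → ℂ)) {Y1 Y2 : Matrix n n ℂ} (h1 : Y1.IsHermitian)
    (h2 : Y2.IsHermitian) : H l Y1 Y2 = ((H l Y1 Y2).re : ℂ) := by
  have := H_star l Y1 Y2
  rw [h1.eq, h2.eq] at this
  exact (Complex.conj_eq_iff_re.mp this).symm

theorem H_cont (l : List (n → ℂ)) {F G : ℝ → Matrix n n ℂ} (hF : Continuous F)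
    (hG : Continuous G) : Continuous fun x => H l (F x) (G x) := by
  induction l generalizing F G with
  | nil => exact hF.matrix_det.mul hG.matrix_det
  | cons u l ih =>
    simp only [H]
    exact ((ih (hF.sub continuous_const) (hG.add continuous_const)).add
      (ih (hF.add continuous_const) (hG.sub continuous_const))).div_const 2

end KS

namespace KS
open Matrix
open scoped ComplexOrder
variable {n : Type*} [Fintype n] [DecidableEq n]

theorem aff_im (D N : ℂ) (h : ∀ t : ℂ, 0 ≤ t.im → D + t * N ≠ 0) :
    (N * star D).im ≤ 0 := by
  by_contra hc
  push Not at hc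
  have hN : N ≠ 0 := by rintro rfl; simp at hc
  apply h (-D / N)
  · have : -D / N = ((Complex.normSq N)⁻¹ : ℝ) * (-(D * star N)) := by
      have h1 : (Complex.normSq N : ℂ) = N * star N := (Complex.mul_conj N).symm
      have h2 : star N ≠ 0 := by simpa using hN
      rw [Complex.ofReal_inv, h1]
      field_simp
    rw [this, Complex.im_ofReal_mul]
    apply mul_nonneg (inv_nonneg.mpr (Complex.normSq_nonneg N))
    simp at hc ⊢
    linarith
  · field_simp; ring

def dH (l : List (n → ℂ)) (Y B : Matrix n n ℂ) : ℂ := H l (Y + B) Y + H l Y (Y + B) - 2 * H l Y Y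

theorem dH_im_of_UH (l : List (n → ℂ)) (Z : Matrix n n ℂ) (hZ : UH Z) (b : n → ℂ) :
    (dH l Z (rk b) * star (H l Z Z)).im ≤ 0 := by
  have h1 := aff_im (H l Z Z) (H l (Z + rk b) Z - H l Z Z) (fun t ht => by
    rw [← H_affine1]; exact H_stable l _ _ (hZ.add_rk b ht) hZ)
  have h2 := aff_im (H l Z Z) (H l Z (Z + rk b) - H l Z Z) (fun t ht => by
    rw [← H_affine2]; exact H_stable l _ _ hZ (hZ.add_rk b ht))
  have : dH l Z (rk b) * star (H l Z Z) = (H l (Z + rk b) Z - H l Z Z) * star (H l Z Z)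
      + (H l Z (Z + rk b) - H l Z Z) * star (H l Z Z) := by rw [dH]; ring
  rw [this, Complex.add_im]
  linarith

theorem herm_quad_im {Y : Matrix n n ℂ} (hY : Y.IsHermitian) (w : n → ℂ) :
    (star w ⬝ᵥ Y *ᵥ w).im = 0 := hY.im_star_dotProduct_mulVec_self w

theorem UH_of_herm {Y : Matrix n n ℂ} (hY : Y.IsHermitian) {z : ℂ} (hz : 0 < z.im) :
    UH (Y + z • (1 : Matrix n n ℂ)) := by
  intro w hw
  rw [add_mulVec, dotProduct_add, Complex.add_im, herm_quad_im hY, smul_mulVec, one_mulVec,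
    dotProduct_smul, smul_eq_mul]
  have h1 : 0 < star w ⬝ᵥ w := dotProduct_star_self_pos_iff.mpr hw
  rw [Complex.pos_iff] at h1
  rw [Complex.mul_im, ← h1.2]
  have := mul_pos hz h1.1
  simp; linarith

theorem dH_im (l : List (n → ℂ)) {Y : Matrix n n ℂ} (hY : Y.IsHermitian) (u b : n → ℂ)
    (s : ℂ) (hs : 0 ≤ s.im) :
    (dH l (Y + s • rk u) (rk b) * star (H l (Y + s • rk u) (Y + s • rk u))).im ≤ 0 := by
  let Z : ℝ → Matrix n n ℂ := fun η => Y + ((η : ℂ) * Complex.I) • (1 : Matrix n n ℂ) + s • rk u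
  have hZc : Continuous Z := by
    apply Continuous.add _ continuous_const
    apply Continuous.add continuous_const
    exact (by fun_prop : Continuous fun η : ℝ => (η : ℂ) * Complex.I).smul continuous_const
  let f : ℝ → ℝ := fun η => (dH l (Z η) (rk b) * star (H l (Z η) (Z η))).im
  have hf : Continuous f := by
    have h1 := H_cont l hZc hZc
    have h2 := H_cont l (hZc.add (continuous_const (y := rk b))) hZc
    have h3 := H_cont l hZc (hZc.add (continuous_const (y := rk b)))
    simp only [f, dH]
    exact Complex.continuous_im.comp (((h2.add h3).sub (continuous_const.mul h1)).mul h1.star)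
  have hpos : ∀ η : ℝ, 0 < η → f η ≤ 0 := by
    intro η hη
    apply dH_im_of_UH
    exact (UH_of_herm hY (z := (η : ℂ) * Complex.I) (by simpa using hη)).add_rk u hs
  have h0 : f 0 ≤ 0 := by
    have : Filter.Tendsto f (nhdsWithin 0 (Set.Ioi 0)) (nhds (f 0)) :=
      (hf.tendsto 0).mono_left nhdsWithin_le_nhds
    apply le_of_tendsto this
    filter_upwards [self_mem_nhdsWithin] with η hη using hpos η hη
  simpa [f, Z] using h0

theorem small_aux (c0 c2 : ℝ) (h : ∀ y : ℝ, 0 < y → y * (c0 + c2 * y ^ 2) ≤ 0) : c0 ≤ 0 := by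
  by_contra hc
  push Not at hc
  have hp : 0 < c0 / (2 * (|c2| + 1)) := by positivity
  have hy := Real.sqrt_pos.mpr hp
  have h1 := h _ hy
  rw [Real.sq_sqrt hp.le] at h1
  have h2 : c0 + c2 * (c0 / (2 * (|c2| + 1))) ≤ 0 := by
    by_contra h3
    push Not at h3
    nlinarith [mul_pos hy h3]
  have h3 : -c0 ≤ c2 * (c0 / (2 * (|c2| + 1))) * 2 := by
    have : c2 * (c0 / (2 * (|c2| + 1))) * 2 = c2 * c0 / (|c2| + 1) := by field_simp
    rw [this, le_div_iff₀ (by positivity)]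
    nlinarith [neg_abs_le c2]
  linarith

theorem wronsk (a0 a1 a2 b0 b1 b2 : ℝ)
    (hW : ∀ s : ℂ, 0 ≤ s.im →
      (((b0 : ℂ) + b1 * s + b2 * s ^ 2) * star ((a0 : ℂ) + a1 * s + a2 * s ^ 2)).im ≤ 0) (x : ℝ) :
    0 ≤ (b0 * a1 - a0 * b1) + 2 * (b0 * a2 - a0 * b2) * x + (b1 * a2 - a1 * b2) * x ^ 2 := by
  have := small_aux (-((b0 * a1 - a0 * b1) + 2 * (b0 * a2 - a0 * b2) * x
    + (b1 * a2 - a1 * b2) * x ^ 2)) (-(a2 * (b1 + 2 * b2 * x)) + b2 * (a1 + 2 * a2 * x)) (by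
    intro y hy
    have h := hW ⟨x, y⟩ hy.le
    refine le_of_eq_of_le ?_ h
    simp [pow_two]
    ring)
  linarith

theorem step_alg (a0 a1 a2 b0 b1 b2 δ φ : ℝ)
    (hW : ∀ s : ℂ, 0 ≤ s.im →
      (((b0 : ℂ) + b1 * s + b2 * s ^ 2) * star ((a0 : ℂ) + a1 * s + a2 * s ^ 2)).im ≤ 0)
    (hD : ∀ s : ℂ, 0 ≤ s.im →
      (((a1 : ℂ) + (2 * a2 : ℝ) * s + (0 : ℝ) * s ^ 2) *
        star ((a0 : ℂ) + a1 * s + a2 * s ^ 2)).im ≤ 0)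
    (hpos : ∀ s : ℝ, 0 ≤ s → 0 < a0 + a1 * s + a2 * s ^ 2)
    (hδ : a1 ≤ δ * a0) (hb : b0 ≤ φ * a0) :
    0 < a0 + a1 * δ + a2 * (δ ^ 2 - 1) ∧
      b0 + b1 * δ + b2 * (δ ^ 2 - 1) ≤ φ * (a0 + a1 * δ + a2 * (δ ^ 2 - 1)) := by
  have ha0 : 0 < a0 := by simpa using hpos 0 le_rfl
  have w := wronsk _ _ _ _ _ _ hW
  have d := wronsk _ _ _ _ _ _ hD
  have ha2 : 0 ≤ a2 := by
    by_contra hc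
    push Not at hc
    have hs : 0 ≤ (a0 + |a1|) / (-a2) + 1 := by
      have : 0 ≤ (a0 + |a1|) / (-a2) := div_nonneg (by positivity) (by linarith)
      linarith
    have h1 := hpos _ hs
    set r := (a0 + |a1|) / (-a2) with hr
    have hr0 : 0 ≤ r := div_nonneg (by positivity) (by linarith)
    have hra : a2 * r = -(a0 + |a1|) := by
      have := hc.ne
      rw [hr]; field_simp
    have e : a2 * (r + 1) ^ 2 = -(a0 + |a1|) * (r + 1) + a2 * (r + 1) := by
      have : a2 * (r + 1) ^ 2 = (a2 * r + a2) * (r + 1) := by ring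
      rw [this, hra]; ring
    rw [e] at h1
    nlinarith [mul_nonneg (sub_nonneg.mpr (le_abs_self a1)) hs, mul_nonneg ha0.le hr0,
      mul_nonneg (neg_nonneg.mpr hc.le) hs]
  have d0 : 2 * a0 * a2 ≤ a1 ^ 2 := by have := d 0; nlinarith
  have ha1 : 0 ≤ a1 := by
    by_contra hc
    push Not at hc
    rcases ha2.eq_or_lt with h | h
    · have := hpos (a0 / (-a1)) (div_nonneg ha0.le (by linarith))
      rw [← h] at this
      have e : a1 * (a0 / (-a1)) = -a0 := by
        have := hc.ne
        field_simp
      rw [e] at this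
      linarith
    · have h1 := hpos (-a1 / (2 * a2)) (div_nonneg (by linarith) (by linarith))
      have h2 := d (-a1 / (2 * a2))
      have e1 : a0 + a1 * (-a1 / (2 * a2)) + a2 * (-a1 / (2 * a2)) ^ 2 =
        (4 * a0 * a2 - a1 ^ 2) / (4 * a2) := by field_simp; ring
      rw [e1] at h1
      have h3 : 0 < 4 * a0 * a2 - a1 ^ 2 := by
        by_contra h4
        have := div_nonpos_of_nonpos_of_nonneg (not_lt.mp h4) (by linarith : 0 ≤ 4 * a2)
        linarith
      have e2 : a1 * a1 - a0 * (2 * a2) + 2 * (a1 * a2 - a0 * 0) * (-a1 / (2 * a2)) +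
        (2 * a2 * a2 - a1 * 0) * (-a1 / (2 * a2)) ^ 2 = (a1 ^ 2 - 4 * a0 * a2) / 2 := by
        field_simp; ring
      rw [e2] at h2
      linarith
  have hδ0 : 0 ≤ δ := by
    by_contra hc
    push Not at hc
    nlinarith
  have h2 : 2 * a2 ≤ a1 * δ := by
    have : a0 * (2 * a2) ≤ a0 * (a1 * δ) := by nlinarith
    exact le_of_mul_le_mul_left this ha0
  have hP : 0 < a0 + a1 * δ + a2 * (δ ^ 2 - 1) := by nlinarith [mul_nonneg ha2 (sq_nonneg δ)]
  refine ⟨hP, ?_⟩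
  set w1 := b0 * a1 - a0 * b1 with hw1
  set w2 := b0 * a2 - a0 * b2 with hw2
  set w3 := b1 * a2 - a1 * b2 with hw3
  have hw10 : 0 ≤ w1 := by simpa using w 0
  have hdisc : w2 ^ 2 ≤ w1 * w3 := by
    have := discrim_le_zero (a := w3) (b := 2 * w2) (c := w1) (fun x => by have := w x; nlinarith)
    rw [discrim] at this
    nlinarith
  have hpl : a0 * w3 = a1 * w2 - a2 * w1 := by rw [hw1, hw2, hw3]; ring
  have h3 : a0 * w2 ^ 2 ≤ w1 * a1 * w2 := by
    have : a0 * w2 ^ 2 ≤ w1 * (a0 * w3) := by nlinarith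
    rw [hpl] at this
    nlinarith [mul_nonneg ha2 (sq_nonneg w1)]
  have hw20 : 0 ≤ w2 := by
    by_contra hc
    push Not at hc
    nlinarith [mul_pos ha0 (mul_pos_of_neg_of_neg hc hc), mul_nonneg hw10 ha1]
  have h4 : w2 ≤ δ * w1 := by
    rcases hw20.eq_or_lt with h | h
    · rw [← h]; positivity
    · have h5 : a0 * w2 ≤ w1 * a1 := by
        have : (a0 * w2) * w2 ≤ (w1 * a1) * w2 := by nlinarith
        exact le_of_mul_le_mul_right this h
      have : a0 * w2 ≤ a0 * (δ * w1) := by nlinarith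
      exact le_of_mul_le_mul_left this ha0
  have h5 : 0 ≤ δ * w1 + (δ ^ 2 - 1) * w2 := by nlinarith [mul_nonneg hw20 (sq_nonneg δ)]
  have h6 : a0 * (b0 + b1 * δ + b2 * (δ ^ 2 - 1)) ≤ b0 * (a0 + a1 * δ + a2 * (δ ^ 2 - 1)) := by
    rw [hw1, hw2] at h5; nlinarith
  have h7 : a0 * (b0 + b1 * δ + b2 * (δ ^ 2 - 1)) ≤
      a0 * (φ * (a0 + a1 * δ + a2 * (δ ^ 2 - 1))) := by nlinarith
  exact le_of_mul_le_mul_left h7 ha0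

theorem quadH (l : List (n → ℂ)) {Y1 Y2 : Matrix n n ℂ} (h1 : Y1.IsHermitian)
    (h2 : Y2.IsHermitian) (u : n → ℂ) : ∃ a0 a1 a2 : ℝ,
    (∀ s : ℂ, H l (Y1 + s • rk u) (Y2 + s • rk u) = a0 + a1 * s + a2 * s ^ 2) ∧
    (∀ δ : ℂ, H (u :: l) (Y1 + δ • rk u) (Y2 + δ • rk u) = a0 + a1 * δ + a2 * (δ ^ 2 - 1)) := by
  have hu : (rk u).IsHermitian := rk_herm u
  have r1 := H_real l h1 h2
  have r2 := H_real l (h1.add hu) h2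
  have r3 := H_real l h1 (h2.add hu)
  have r4 := H_real l (h1.add hu) (h2.add hu)
  set α := (H l Y1 Y2).re
  set β := (H l (Y1 + rk u) Y2).re
  set γ := (H l Y1 (Y2 + rk u)).re
  set κ := (H l (Y1 + rk u) (Y2 + rk u)).re
  refine ⟨α, (β - α) + (γ - α), κ - β - γ + α, ?_, ?_⟩
  · intro s
    rw [H_biaffine, r1, r2, r3, r4]
    push_cast; ring
  · intro δ
    rw [H]
    have e1 : ∀ Y : Matrix n n ℂ, Y + δ • rk u - rk u = Y + (δ - 1) • rk u := by
      intro Y; rw [sub_smul, one_smul]; abel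
    have e2 : ∀ Y : Matrix n n ℂ, Y + δ • rk u + rk u = Y + (δ + 1) • rk u := by
      intro Y; rw [add_smul, one_smul]; abel
    rw [e1, e1, e2, e2, H_biaffine, H_biaffine, r1, r2, r3, r4]
    push_cast; ring

theorem dquadH (l : List (n → ℂ)) {Y : Matrix n n ℂ} (h1 : Y.IsHermitian)
    (u b : n → ℂ) : ∃ a0 a1 a2 : ℝ,
    (∀ s : ℂ, dH l (Y + s • rk u) (rk b) = a0 + a1 * s + a2 * s ^ 2) ∧
    (∀ δ : ℂ, dH (u :: l) (Y + δ • rk u) (rk b) = a0 + a1 * δ + a2 * (δ ^ 2 - 1)) := by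
  have hb : (rk b).IsHermitian := rk_herm b
  obtain ⟨a0, a1, a2, h, h'⟩ := quadH l h1 h1 u
  obtain ⟨c0, c1, c2, k, k'⟩ := quadH l (h1.add hb) h1 u
  obtain ⟨d0, d1, d2, m, m'⟩ := quadH l h1 (h1.add hb) u
  have e : ∀ s : ℂ, Y + s • rk u + rk b = Y + rk b + s • rk u := by intro s; abel
  refine ⟨c0 + d0 - 2 * a0, c1 + d1 - 2 * a1, c2 + d2 - 2 * a2, ?_, ?_⟩
  · intro s
    rw [dH, e, h, k, m]; push_cast; ring
  · intro s
    rw [dH, e, h', k', m']; push_cast; ring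

theorem barrier_step (l : List (n → ℂ)) {Y : Matrix n n ℂ} (hY : Y.IsHermitian) (u : n → ℂ)
    (δ : ℝ) (hpos : ∀ s : ℝ, 0 ≤ s → 0 < (H l (Y + (s : ℂ) • rk u) (Y + (s : ℂ) • rk u)).re)
    (hδ : (dH l Y (rk u)).re ≤ δ * (H l Y Y).re) :
    0 < (H (u :: l) (Y + (δ : ℂ) • rk u) (Y + (δ : ℂ) • rk u)).re ∧
    ∀ (b : n → ℂ) (φ : ℝ), (dH l Y (rk b)).re ≤ φ * (H l Y Y).re →
      (dH (u :: l) (Y + (δ : ℂ) • rk u) (rk b)).re ≤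
        φ * (H (u :: l) (Y + (δ : ℂ) • rk u) (Y + (δ : ℂ) • rk u)).re := by
  obtain ⟨a0, a1, a2, h, h'⟩ := quadH l hY hY u
  have hdu : ∀ s : ℂ, dH l (Y + s • rk u) (rk u) = a1 + (2 * a2 : ℝ) * s + (0 : ℝ) * s ^ 2 := by
    intro s
    have e : Y + s • rk u + rk u = Y + (s + 1) • rk u := by rw [add_smul, one_smul]; abel
    have f1 := H_affine1 l (Y + s • rk u) (Y + s • rk u) u 1
    have k := H_biaffine l Y Y u (s + 1) s
    have k' := H_biaffine l Y Y u s (s + 1)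
    have k0 := H_biaffine l Y Y u 0 0
    have h0 := h 0
    have h1 := h 1
    have h2 := h (-1)
    rw [H_biaffine] at h0 h1 h2
    rw [dH, e, k, k', H_biaffine]
    push_cast
    linear_combination (1 / 2 : ℂ) * (h1 - h2) + (2 * s) * ((1 / 2 : ℂ) * (h1 + h2) - h0)
  have rH : (H l Y Y).re = a0 := by
    have := h 0
    simp at this
    simp [this]
  have rd : (dH l Y (rk u)).re = a1 := by
    have := hdu 0
    simp at this
    simp [this]
  have rH' : (H (u :: l) (Y + (δ : ℂ) • rk u) (Y + (δ : ℂ) • rk u)).re =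
      a0 + a1 * δ + a2 * (δ ^ 2 - 1) := by
    rw [h' δ, ← Complex.ofReal_re (a0 + a1 * δ + a2 * (δ ^ 2 - 1))]
    push_cast; rfl
  have main : ∀ (b : n → ℂ) (φ : ℝ), (dH l Y (rk b)).re ≤ φ * (H l Y Y).re →
      0 < (H (u :: l) (Y + (δ : ℂ) • rk u) (Y + (δ : ℂ) • rk u)).re ∧
      (dH (u :: l) (Y + (δ : ℂ) • rk u) (rk b)).re ≤
        φ * (H (u :: l) (Y + (δ : ℂ) • rk u) (Y + (δ : ℂ) • rk u)).re := by
    intro b φ hb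
    obtain ⟨b0, b1, b2, k, k'⟩ := dquadH l hY u b
    have rb : (dH l Y (rk b)).re = b0 := by
      have := k 0
      simp at this
      simp [this]
    have rb' : (dH (u :: l) (Y + (δ : ℂ) • rk u) (rk b)).re = b0 + b1 * δ + b2 * (δ ^ 2 - 1) := by
      rw [k' δ, ← Complex.ofReal_re (b0 + b1 * δ + b2 * (δ ^ 2 - 1))]
      push_cast; rfl
    rw [rH', rb']
    apply step_alg
    · intro s hs
      have := dH_im l hY u b s hs
      rwa [h, k] at this
    · intro s hs
      have := dH_im l hY u u s hs
      rwa [h, hdu] at this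
    · intro s hs
      have := hpos s hs
      rw [h s] at this
      rw [← Complex.ofReal_re (a0 + a1 * s + a2 * s ^ 2)]
      push_cast; exact this
    · rw [← rH, ← rd]; exact hδ
    · rw [← rb, ← rH]; exact hb
  exact ⟨(main u δ hδ).1, fun b φ hb => (main b φ hb).2⟩

end KS

namespace KS
open Matrix
open scoped ComplexOrder
variable {n : Type*} [Fintype n] [DecidableEq n]

def nsq (u : n → ℂ) : ℝ := ∑ i, ‖u i‖ ^ 2

theorem star_dot_self (u : n → ℂ) : star u ⬝ᵥ u = (nsq u : ℂ) := by
  simp [dotProduct, nsq, Complex.conj_mul']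

theorem nsq_nonneg (u : n → ℂ) : 0 ≤ nsq u := Finset.sum_nonneg fun _ _ => by positivity

theorem cauchy (b w : n → ℂ) : ‖star b ⬝ᵥ w‖ ^ 2 ≤ nsq b * nsq w := by
  have h1 : ‖star b ⬝ᵥ w‖ ≤ ∑ i, ‖b i‖ * ‖w i‖ := by
    refine (norm_sum_le _ _).trans (le_of_eq ?_)
    simp
  calc ‖star b ⬝ᵥ w‖ ^ 2 ≤ (∑ i, ‖b i‖ * ‖w i‖) ^ 2 := by gcongr
    _ ≤ _ := Finset.sum_mul_sq_le_sq_mul_sq _ _ _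

theorem psd_of {M : Matrix n n ℂ} (hM : M.IsHermitian)
    (h : ∀ w : n → ℂ, 0 ≤ (star w ⬝ᵥ M *ᵥ w).re) : M.PosSemidef := by
  apply PosSemidef.of_dotProduct_mulVec_nonneg hM
  intro w
  rw [Complex.nonneg_iff]
  exact ⟨h w, (herm_quad_im hM w).symm⟩

theorem rk_psd (u : n → ℂ) : (rk u).PosSemidef := posSemidef_vecMulVec_self_star u

theorem real_smul_herm {M : Matrix n n ℂ} (hM : M.IsHermitian) (s : ℝ) :
    ((s : ℂ) • M).IsHermitian := by
  rw [IsHermitian, conjTranspose_smul, hM.eq]; simp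

theorem smul_psd {M : Matrix n n ℂ} (hM : M.PosSemidef) {s : ℝ} (hs : 0 ≤ s) :
    ((s : ℂ) • M).PosSemidef := hM.smul (by exact_mod_cast hs : (0 : ℂ) ≤ (s : ℂ))

theorem one_sub_rk_psd (b : n → ℂ) : (((nsq b : ℝ) : ℂ) • (1 : Matrix n n ℂ) - rk b).PosSemidef := by
  apply psd_of ((real_smul_herm isHermitian_one _).sub (rk_herm b))
  intro w
  rw [sub_mulVec, dotProduct_sub, quad_rk, smul_mulVec, one_mulVec, dotProduct_smul, star_dot_self]
  have := cauchy b w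
  rw [smul_eq_mul, ← Complex.ofReal_mul, ← Complex.ofReal_sub, Complex.ofReal_re]
  linarith

def Inv (φ : ℝ) (l : List (n → ℂ)) (Y : Matrix n n ℂ) : Prop :=
  Y.IsHermitian ∧ ∀ P : Matrix n n ℂ, P.PosSemidef →
    0 < (H l (Y + P) (Y + P)).re ∧ ∀ b : n → ℂ,
      (dH l (Y + P) (rk b)).re ≤ φ * nsq b * (H l (Y + P) (Y + P)).re

theorem inv_base {x : ℝ} (hx : 0 < x) {Y0 : Matrix n n ℂ}
    (h : (Y0 - ((x / 2 : ℝ) : ℂ) • (1 : Matrix n n ℂ)).PosSemidef) : Inv (4 / x) [] Y0 := by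
  have h1 : (((x / 2 : ℝ) : ℂ) • (1 : Matrix n n ℂ)).PosDef :=
    PosDef.smul PosDef.one (by exact_mod_cast half_pos hx : (0 : ℂ) < ((x / 2 : ℝ) : ℂ))
  have hY0 : Y0.PosDef := by
    have := h1.posSemidef_add h
    rwa [sub_add_cancel] at this
  refine ⟨hY0.isHermitian, fun P hP => ?_⟩
  have hY : (Y0 + P).PosDef := hY0.add_posSemidef hP
  have hY2 : (Y0 + P - ((x / 2 : ℝ) : ℂ) • (1 : Matrix n n ℂ)).PosSemidef := by
    have := h.add hP
    rwa [sub_add_eq_add_sub] at this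
  set Y := Y0 + P
  have hdet := hY.det_pos
  obtain ⟨D, hD⟩ : ∃ D : ℝ, Y.det = D := ⟨Y.det.re, by
    rw [Complex.pos_iff] at hdet
    apply Complex.ext <;> simp [← hdet.2]⟩
  have hD0 : 0 < D := by rw [hD] at hdet; exact_mod_cast hdet
  have hHH : (H [] Y Y).re = D * D := by
    rw [H, hD, ← Complex.ofReal_mul, Complex.ofReal_re]
  refine ⟨by rw [hHH]; positivity, fun b => ?_⟩
  have hdetb := (hY.add_posSemidef (rk_psd b)).det_pos
  obtain ⟨E, hE⟩ : ∃ E : ℝ, (Y + rk b).det = E := ⟨(Y + rk b).det.re, by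
    rw [Complex.pos_iff] at hdetb
    apply Complex.ext <;> simp [← hdetb.2]⟩
  have hdH : (dH [] Y (rk b)).re = 2 * D * (E - D) := by
    rw [dH]
    simp only [H]
    rw [hD, hE, ← Complex.ofReal_re (2 * D * (E - D))]
    push_cast; ring_nf
  rw [hdH, hHH]
  have key : x * (E - D) ≤ 2 * nsq b * D := by
    rcases (nsq_nonneg b).eq_or_lt with h0 | h0
    · have hb : b = 0 := by
        have h2 : star b ⬝ᵥ b = 0 := by rw [star_dot_self, ← h0]; simp
        exact dotProduct_star_self_eq_zero.mp h2
      have : rk b = 0 := by rw [hb]; ext; simp [rk, vecMulVec_apply]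
      rw [this, add_zero, hD] at hE
      have : D = E := by exact_mod_cast hE
      rw [← h0, this]; simp
    · have hp : (Y + ((-(x / (2 * nsq b)) : ℝ) : ℂ) • rk b).PosSemidef := by
        have e : Y + ((-(x / (2 * nsq b)) : ℝ) : ℂ) • rk b =
            (Y - ((x / 2 : ℝ) : ℂ) • (1 : Matrix n n ℂ)) +
            ((x / (2 * nsq b) : ℝ) : ℂ) • (((nsq b : ℝ) : ℂ) • (1 : Matrix n n ℂ) - rk b) := by
          rw [smul_sub, smul_smul, ← Complex.ofReal_mul,
            show x / (2 * nsq b) * nsq b = x / 2 by field_simp, Complex.ofReal_neg, neg_smul]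
          abel
        rw [e]
        exact hY2.add (smul_psd (one_sub_rk_psd b) (by positivity))
      have h3 := hp.det_nonneg
      rw [rk, det_affine, ← rk, hD, hE] at h3
      have h4 : 0 ≤ D + (-(x / (2 * nsq b))) * (E - D) := by exact_mod_cast h3
      have h5 : 0 ≤ 2 * nsq b * (D + (-(x / (2 * nsq b))) * (E - D)) := by positivity
      have h6 : 2 * nsq b * (D + (-(x / (2 * nsq b))) * (E - D)) = 2 * nsq b * D - x * (E - D) := by
        field_simp; ring
      linarith
  have : 4 / x * nsq b * (D * D) = 2 * D * (2 * nsq b * D) / x := by field_simp; ring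
  rw [this, le_div_iff₀ hx]
  nlinarith

theorem inv_step {φ : ℝ} {l : List (n → ℂ)} {Y : Matrix n n ℂ} (h : Inv φ l Y) (hφ : 0 ≤ φ)
    (u : n → ℂ) : Inv φ (u :: l) (Y + ((φ * nsq u : ℝ) : ℂ) • rk u) := by
  refine ⟨h.1.add (real_smul_herm (rk_herm u) _), fun P hP => ?_⟩
  have e : Y + ((φ * nsq u : ℝ) : ℂ) • rk u + P = Y + P + ((φ * nsq u : ℝ) : ℂ) • rk u := by abel
  rw [e]
  obtain ⟨h1, h2⟩ := barrier_step l (h.1.add hP.isHermitian) u (φ * nsq u) (fun s hs => by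
    have := (h.2 (P + (s : ℂ) • rk u) (hP.add (smul_psd (rk_psd u) hs))).1
    rwa [← add_assoc] at this) ((h.2 P hP).2 u)
  exact ⟨h1, fun b => h2 b _ ((h.2 P hP).2 b)⟩

def shift (φ : ℝ) (l : List (n → ℂ)) : Matrix n n ℂ :=
  (l.map fun u => ((φ * nsq u : ℝ) : ℂ) • rk u).sum

theorem inv_all {φ : ℝ} {Y : Matrix n n ℂ} (h : Inv φ [] Y) (hφ : 0 ≤ φ) (l : List (n → ℂ)) :
    Inv φ l (Y + shift φ l) := by
  induction l with
  | nil => simpa [shift] using h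
  | cons u l ih =>
    have := inv_step ih hφ u
    rw [add_assoc] at this
    rw [shift, List.map_cons, List.sum_cons, add_comm (_ • _)]
    exact this

theorem shift_herm (φ : ℝ) (l : List (n → ℂ)) : (shift φ l).IsHermitian := by
  induction l with
  | nil => simp [shift]
  | cons u l ih =>
    rw [shift, List.map_cons, List.sum_cons]
    exact (real_smul_herm (rk_herm u) _).add ih

theorem shift_quad (φ : ℝ) (l : List (n → ℂ)) (w : n → ℂ) :
    (star w ⬝ᵥ shift φ l *ᵥ w).re = φ * (l.map fun u => nsq u * ‖star u ⬝ᵥ w‖ ^ 2).sum := by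
  induction l with
  | nil => simp [shift]
  | cons u l ih =>
    rw [shift, List.map_cons, List.sum_cons, add_mulVec, dotProduct_add, Complex.add_re,
      smul_mulVec, dotProduct_smul, quad_rk, smul_eq_mul, ← Complex.ofReal_mul, Complex.ofReal_re]
    rw [shift] at ih
    rw [ih, List.map_cons, List.sum_cons]
    ring

/-- The expected polynomial is positive beyond `√8 σ`. -/
theorem H_pos (l : List (n → ℂ)) (σ2 x : ℝ) (hx : 0 < x) (hσ : 8 * σ2 ≤ x ^ 2)
    (h : ∀ w : n → ℂ, (l.map fun u => nsq u * ‖star u ⬝ᵥ w‖ ^ 2).sum ≤ σ2 * nsq w) :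
    0 < (H l ((x : ℂ) • (1 : Matrix n n ℂ)) ((x : ℂ) • 1)).re := by
  have hb : ((x : ℂ) • (1 : Matrix n n ℂ) - shift (4 / x) l
      - ((x / 2 : ℝ) : ℂ) • (1 : Matrix n n ℂ)).PosSemidef := by
    apply psd_of (((real_smul_herm isHermitian_one _).sub (shift_herm _ l)).sub
      (real_smul_herm isHermitian_one _))
    intro w
    rw [sub_mulVec, sub_mulVec, dotProduct_sub, dotProduct_sub, Complex.sub_re, Complex.sub_re,
      shift_quad]
    simp only [smul_mulVec, one_mulVec, dotProduct_smul, star_dot_self, smul_eq_mul,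
      ← Complex.ofReal_mul, Complex.ofReal_re]
    have h1 := h w
    have h2 : 4 / x * (l.map fun u => nsq u * ‖star u ⬝ᵥ w‖ ^ 2).sum ≤ 4 / x * (σ2 * nsq w) := by
      gcongr
    have h3 : 4 / x * (σ2 * nsq w) ≤ x / 2 * nsq w := by
      have : 4 / x * σ2 ≤ x / 2 := by
        rw [div_mul_eq_mul_div, div_le_div_iff₀ hx (by norm_num)]
        nlinarith
      calc _ = (4 / x * σ2) * nsq w := by ring
        _ ≤ _ := mul_le_mul_of_nonneg_right this (nsq_nonneg w)
    linarith
  have := ((inv_all (inv_base hx hb) (by positivity) l).2 0 PosSemidef.zero).1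
  simpa using this

end KS

namespace KS
open Matrix
open scoped ComplexOrder
variable {n : Type*} [Fintype n] [DecidableEq n]

theorem greedy_abs (f g : ℝ → ℝ) (x0 R : ℝ) (hf : Continuous f) (hg : Continuous g)
    (hmono : ∀ t : ℝ, 0 ≤ t → t ≤ 1 → (∀ x, x0 ≤ x → 0 < t * f x + (1 - t) * g x) →
      ∀ x, x0 ≤ x → t * f x0 + (1 - t) * g x0 ≤ t * f x + (1 - t) * g x)
    (hgpos : ∀ x, x0 ≤ x → 0 < g x) (hf0 : 0 < f x0) (hfR : ∀ x, R ≤ x → 0 < f x) :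
    ∀ x, x0 ≤ x → 0 < f x := by
  by_contra hc
  push Not at hc
  obtain ⟨x1, hx1, hfx1⟩ := hc
  have hx1R : x1 < R := by
    by_contra h
    have := hfR x1 (not_lt.mp h)
    linarith
  have hr : ContinuousOn (fun x => f x / g x) (Set.Icc x0 R) :=
    hf.continuousOn.div hg.continuousOn fun x hx => (hgpos x hx.1).ne'
  obtain ⟨x2, hx2, hmin⟩ := isCompact_Icc.exists_isMinOn ⟨x1, hx1, hx1R.le⟩ hr
  set ρ := -(f x2 / g x2) with hρ
  have hρ0 : 0 ≤ ρ := by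
    have h1 : f x2 / g x2 ≤ f x1 / g x1 := hmin ⟨hx1, hx1R.le⟩
    have h2 : f x1 / g x1 ≤ 0 := div_nonpos_of_nonpos_of_nonneg hfx1 (hgpos x1 hx1).le
    rw [hρ]; linarith
  have hlow : ∀ x, x0 ≤ x → -ρ * g x ≤ f x := by
    intro x hx
    rcases le_total x R with h | h
    · have h1 : f x2 / g x2 ≤ f x / g x := hmin ⟨hx, h⟩
      rw [le_div_iff₀ (hgpos x hx)] at h1
      simpa [hρ] using h1
    · have := hfR x h
      have := hgpos x hx
      nlinarith
  have h2 : f x2 = -ρ * g x2 := by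
    have := (hgpos x2 hx2.1).ne'
    rw [hρ]; field_simp
  set T := 1 / (1 + ρ) with hT
  have hT0 : 0 < T := by positivity
  have hT1 : T ≤ 1 := by rw [hT, div_le_one (by positivity)]; linarith
  have hTρ : 1 - T = T * ρ := by rw [hT]; field_simp; ring
  have hlt : ∀ t, 0 ≤ t → t < T → t * f x0 + (1 - t) * g x0 ≤ t * f x2 + (1 - t) * g x2 := by
    intro t ht htT
    apply hmono t ht (by linarith) _ x2 hx2.1
    intro x hx
    have h3 := hlow x hx
    have h4 := hgpos x hx
    have h5 : t * ρ < 1 - t := by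
      have : t * ρ ≤ T * ρ := by gcongr
      linarith
    nlinarith [mul_le_mul_of_nonneg_left h3 ht, mul_pos (sub_pos.mpr h5) h4]
  have hlim : T * f x0 + (1 - T) * g x0 ≤ T * f x2 + (1 - T) * g x2 := by
    have c1 : Continuous fun t : ℝ => t * f x0 + (1 - t) * g x0 := by fun_prop
    have c2 : Continuous fun t : ℝ => t * f x2 + (1 - t) * g x2 := by fun_prop
    have : (nhdsWithin T (Set.Iio T)).NeBot := inferInstance
    refine le_of_tendsto_of_tendsto (b := nhdsWithin T (Set.Iio T))
      ((c1.tendsto T).mono_left nhdsWithin_le_nhds) ((c2.tendsto T).mono_left nhdsWithin_le_nhds) ?_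
    filter_upwards [Ioo_mem_nhdsLT hT0] with t ht using hlt t ht.1.le ht.2
  have : T * f x2 + (1 - T) * g x2 = 0 := by rw [h2, hTρ]; ring
  have := mul_pos hT0 hf0
  have := mul_nonneg (sub_nonneg.mpr hT1) (hgpos x0 le_rfl).le
  linarith

open Polynomial in
theorem eval_prod (p : ℂ[X]) (hp : p.Monic) (hr : ∀ r ∈ p.roots, r.im = 0) (x : ℝ) :
    p.eval (x : ℂ) = (((p.roots.map fun r => x - r.re).prod : ℝ) : ℂ) := by
  have hs := IsAlgClosed.splits p
  have h := hs.eq_prod_roots_of_monic hp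
  conv_lhs => rw [h]
  have e : (((p.roots.map fun r => x - r.re).prod : ℝ) : ℂ) =
      (p.roots.map fun r => (((x - r.re : ℝ)) : ℂ)).prod := by
    have := map_multiset_prod Complex.ofRealHom (p.roots.map fun r => x - r.re)
    rw [Multiset.map_map] at this
    exact this
  rw [e, eval_multiset_prod, Multiset.map_map]
  congr 1
  apply Multiset.map_congr rfl
  intro r hrr
  simp
  apply Complex.ext <;> simp [hr r hrr]

open Polynomial in
theorem mono_of_roots (p : ℂ[X]) (hp : p.Monic) (hr : ∀ r ∈ p.roots, r.im = 0) (x0 : ℝ)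
    (h : ∀ x : ℝ, x0 ≤ x → p.eval (x : ℂ) ≠ 0) (x : ℝ) (hx : x0 ≤ x) :
    0 < (p.eval (x0 : ℂ)).re ∧ (p.eval (x0 : ℂ)).re ≤ (p.eval (x : ℂ)).re := by
  rw [eval_prod p hp hr, eval_prod p hp hr, Complex.ofReal_re, Complex.ofReal_re]
  have hlt : ∀ r ∈ p.roots, r.re < x0 := by
    intro r hrr
    by_contra hc
    apply h r.re (not_lt.mp hc)
    have : (r.re : ℂ) = r := by apply Complex.ext <;> simp [hr r hrr]
    rw [this]
    exact (mem_roots'.mp hrr).2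
  constructor
  · apply Multiset.prod_pos
    intro a ha
    obtain ⟨r, hrr, rfl⟩ := Multiset.mem_map.mp ha
    have := hlt r hrr
    linarith
  · apply Multiset.prod_map_le_prod_map₀
    · intro r hrr
      have := hlt r hrr
      linarith
    · intro r hrr
      linarith

open Polynomial in
theorem exists_bound (p : ℂ[X]) (hp : p.Monic) (hr : ∀ r ∈ p.roots, r.im = 0) :
    ∃ R : ℝ, ∀ x : ℝ, R ≤ x → 0 < (p.eval (x : ℂ)).re := by
  obtain ⟨R, hR⟩ : ∃ R : ℝ, ∀ r ∈ p.roots.toFinset, r.re < R := by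
    obtain ⟨R, hR⟩ := (p.roots.toFinset.image Complex.re).bddAbove
    refine ⟨R + 1, fun r hrr => ?_⟩
    have := hR (Finset.mem_coe.mpr (Finset.mem_image_of_mem Complex.re hrr))
    linarith
  refine ⟨R, fun x hx => ?_⟩
  rw [eval_prod p hp hr, Complex.ofReal_re]
  apply Multiset.prod_pos
  intro a ha
  obtain ⟨r, hrr, rfl⟩ := Multiset.mem_map.mp ha
  have := hR r (Multiset.mem_toFinset.mpr hrr)
  linarith

open Polynomial in
theorem comb_monic (p q : ℂ[X]) (k : ℕ) (hp : p.Monic) (hq : q.Monic) (hpk : p.natDegree = k)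
    (hqk : q.natDegree = k) (s t : ℂ) (hst : s + t = 1) :
    (C s * p + C t * q).Monic ∧ (C s * p + C t * q).natDegree = k := by
  have h1 : (C s * p + C t * q).natDegree ≤ k := by
    apply natDegree_add_le_of_degree_le
    · exact (natDegree_C_mul_le _ _).trans hpk.le
    · exact (natDegree_C_mul_le _ _).trans hqk.le
  have h2 : (C s * p + C t * q).coeff k = 1 := by
    have e1 : p.coeff k = 1 := by rw [← hpk]; exact hp
    have e2 : q.coeff k = 1 := by rw [← hqk]; exact hq
    simp [e1, e2, hst]
  have hm := monic_of_natDegree_le_of_coeff_eq_one k h1 h2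
  refine ⟨hm, le_antisymm h1 ?_⟩
  apply le_natDegree_of_ne_zero
  rw [h2]; exact one_ne_zero

open Polynomial in
def PP : List (n → ℂ) → Matrix n n ℂ → ℂ[X]
  | [], S => S.charpoly * (-S).charpoly
  | u :: l, S => C (1 / 2) * PP l (S + rk u) + C (1 / 2) * PP l (S - rk u)

theorem PP_eval (l : List (n → ℂ)) (S : Matrix n n ℂ) (z : ℂ) :
    (PP l S).eval z = H l (z • (1 : Matrix n n ℂ) - S) (z • (1 : Matrix n n ℂ) + S) := by
  induction l generalizing S with
  | nil =>
    rw [PP, H, Polynomial.eval_mul, eval_charpoly, eval_charpoly, sub_neg_eq_add]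
    simp [smul_one_eq_diagonal, scalar_apply]
  | cons u l ih =>
    rw [PP, H]
    simp only [Polynomial.eval_add, Polynomial.eval_mul, Polynomial.eval_C, ih]
    rw [sub_add_eq_sub_sub, add_assoc, sub_sub_eq_add_sub, ← sub_add_eq_add_sub, ← add_sub_assoc]
    ring

theorem PP_monic (l : List (n → ℂ)) (S : Matrix n n ℂ) :
    (PP l S).Monic ∧ (PP l S).natDegree = 2 * Fintype.card n := by
  induction l generalizing S with
  | nil =>
    rw [PP]
    refine ⟨(charpoly_monic _).mul (charpoly_monic _), ?_⟩
    rw [(charpoly_monic _).natDegree_mul (charpoly_monic _), charpoly_natDegree_eq_dim,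
      charpoly_natDegree_eq_dim]
    ring
  | cons u l ih =>
    rw [PP]
    exact comb_monic _ _ _ (ih _).1 (ih _).1 (ih _).2 (ih _).2 _ _ (by norm_num)

/-- real-rootedness of convex combinations -/
theorem PP_comb_real (l : List (n → ℂ)) {S : Matrix n n ℂ} (hS : S.IsHermitian) (u : n → ℂ)
    (t : ℝ) (ht0 : 0 ≤ t) (ht1 : t ≤ 1) (z : ℂ)
    (hz : (t : ℂ) * (PP l (S + rk u)).eval z + ((1 - t : ℝ) : ℂ) * (PP l (S - rk u)).eval z = 0) :
    z.im = 0 := by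
  have e : ∀ z : ℂ, (t : ℂ) * (PP l (S + rk u)).eval z +
      ((1 - t : ℝ) : ℂ) * (PP l (S - rk u)).eval z =
      (t : ℂ) * H l (z • (1 : Matrix n n ℂ) - S - rk u) (z • (1 : Matrix n n ℂ) + S + rk u) +
      ((1 - t : ℝ) : ℂ) * H l (z • (1 : Matrix n n ℂ) - S + rk u)
        (z • (1 : Matrix n n ℂ) + S - rk u) := by
    intro z
    rw [PP_eval, PP_eval, sub_add_eq_sub_sub, add_assoc, sub_sub_eq_add_sub,
      ← sub_add_eq_add_sub, ← add_sub_assoc]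
  have main : ∀ z : ℂ, 0 < z.im → (t : ℂ) * (PP l (S + rk u)).eval z +
      ((1 - t : ℝ) : ℂ) * (PP l (S - rk u)).eval z ≠ 0 := by
    intro z hz
    rw [e]
    apply H_stable_biased l u _ _ _ _ t ht0 ht1
    · have := UH_of_herm hS.neg hz
      rwa [neg_add_eq_sub] at this
    · have := UH_of_herm hS hz
      rwa [add_comm] at this
  rcases lt_trichotomy z.im 0 with h | h | h
  · exfalso
    apply main (star z) (by simpa using h)
    have := congrArg star hz
    rw [e] at this
    rw [e]
    simp only [star_add, star_mul', H_star, conjTranspose_add, conjTranspose_sub, rk_herm, hS.eq,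
      conjTranspose_smul, conjTranspose_one] at this
    simpa using this
  · exact h
  · exact absurd hz (main z h)

def NR (x0 : ℝ) (l : List (n → ℂ)) (S : Matrix n n ℂ) : Prop :=
  ∀ x : ℝ, x0 ≤ x → (PP l S).eval (x : ℂ) ≠ 0

theorem PP_real (l : List (n → ℂ)) {S : Matrix n n ℂ} (hS : S.IsHermitian) (x : ℝ) :
    (PP l S).eval (x : ℂ) = (((PP l S).eval (x : ℂ)).re : ℂ) := by
  rw [PP_eval]
  exact H_real l ((real_smul_herm isHermitian_one x).sub hS)
    ((real_smul_herm isHermitian_one x).add hS)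

theorem greedy_step_aux (x0 : ℝ) (l : List (n → ℂ)) (p q : Polynomial ℂ) (k : ℕ)
    (hp : p.Monic) (hq : q.Monic) (hpk : p.natDegree = k) (hqk : q.natDegree = k)
    (hreal : ∀ t : ℝ, 0 ≤ t → t ≤ 1 → ∀ z : ℂ,
      (t : ℂ) * p.eval z + ((1 - t : ℝ) : ℂ) * q.eval z = 0 → z.im = 0)
    (hpr : ∀ x : ℝ, p.eval (x : ℂ) = ((p.eval (x : ℂ)).re : ℂ))
    (hqr : ∀ x : ℝ, q.eval (x : ℂ) = ((q.eval (x : ℂ)).re : ℂ))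
    (hpq : ∀ x : ℝ, x0 ≤ x → 0 < (p.eval (x : ℂ)).re + (q.eval (x : ℂ)).re)
    (hp0 : 0 < (p.eval (x0 : ℂ)).re) :
    ∀ x : ℝ, x0 ≤ x → 0 < (p.eval (x : ℂ)).re := by
  have cp : Continuous fun x : ℝ => (p.eval (x : ℂ)).re :=
    Complex.continuous_re.comp (p.continuous.comp Complex.continuous_ofReal)
  have cq : Continuous fun x : ℝ => (q.eval (x : ℂ)).re :=
    Complex.continuous_re.comp (q.continuous.comp Complex.continuous_ofReal)
  obtain ⟨R, hR⟩ := exists_bound p hp (fun r hr => by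
    apply hreal 1 (by norm_num) le_rfl
    have := (Polynomial.mem_roots'.mp hr).2
    rw [Polynomial.IsRoot] at this
    simp [this])
  apply greedy_abs (fun x : ℝ => (p.eval (x : ℂ)).re)
    (fun x : ℝ => ((p.eval (x : ℂ)).re + (q.eval (x : ℂ)).re) / 2) x0 R cp
    ((cp.add cq).div_const 2) _ (fun x hx => half_pos (hpq x hx)) hp0 hR
  intro t ht0 ht1 hpos x hx
  set s := t + (1 - t) / 2 with hs
  have hsx : ∀ x : ℝ, t * (p.eval (x : ℂ)).re +
      (1 - t) * (((p.eval (x : ℂ)).re + (q.eval (x : ℂ)).re) / 2) =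
      (Polynomial.eval (x : ℂ)
        (Polynomial.C (s : ℂ) * p + Polynomial.C ((1 - s : ℝ) : ℂ) * q)).re := by
    intro x
    simp only [Polynomial.eval_add, Polynomial.eval_mul, Polynomial.eval_C]
    rw [Complex.add_re, Complex.re_ofReal_mul, Complex.re_ofReal_mul, hs]
    ring
  simp only [hsx] at hpos ⊢
  have hm := comb_monic p q k hp hq hpk hqk (s : ℂ) ((1 - s : ℝ) : ℂ) (by push_cast; ring)
  refine (mono_of_roots _ hm.1 ?_ x0 ?_ x hx).2
  · intro r hr
    apply hreal s (by rw [hs]; linarith) (by rw [hs]; linarith)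
    have := (Polynomial.mem_roots'.mp hr).2
    simpa [Polynomial.IsRoot] using this
  · intro y hy h0
    have := hpos y hy
    rw [h0] at this
    simp at this

theorem greedy_step (x0 : ℝ) (l : List (n → ℂ)) (u : n → ℂ) {S : Matrix n n ℂ}
    (hS : S.IsHermitian) (h : NR x0 (u :: l) S) : NR x0 l (S + rk u) ∨ NR x0 l (S - rk u) := by
  have hSp : (S + rk u).IsHermitian := hS.add (rk_herm u)
  have hSm : (S - rk u).IsHermitian := hS.sub (rk_herm u)
  have hreal := PP_comb_real l hS u
  have hpq : ∀ x : ℝ, x0 ≤ x →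
      0 < ((PP l (S + rk u)).eval (x : ℂ)).re + ((PP l (S - rk u)).eval (x : ℂ)).re := by
    intro x hx
    have h1 := (mono_of_roots (PP (u :: l) S) (PP_monic _ _).1 (fun r hr => by
      apply hreal (1 / 2) (by norm_num) (by norm_num)
      have := (Polynomial.mem_roots'.mp hr).2
      rw [Polynomial.IsRoot, PP] at this
      simp only [Polynomial.eval_add, Polynomial.eval_mul, Polynomial.eval_C] at this
      rw [← this]; push_cast; ring) x0 h x hx)
    have h2 := lt_of_lt_of_le h1.1 h1.2
    rw [PP] at h2
    simp only [Polynomial.eval_add, Polynomial.eval_mul, Polynomial.eval_C] at h2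
    rw [← mul_add, show (1 / 2 : ℂ) = ((1 / 2 : ℝ) : ℂ) by push_cast; rfl, Complex.re_ofReal_mul,
      Complex.add_re] at h2
    linarith
  have h0 := hpq x0 le_rfl
  rcases lt_or_ge 0 ((PP l (S + rk u)).eval (x0 : ℂ)).re with hc | hc
  · left
    intro x hx h1
    have := greedy_step_aux x0 l _ _ _ (PP_monic l (S + rk u)).1 (PP_monic l (S - rk u)).1
      (PP_monic l (S + rk u)).2 (PP_monic l (S - rk u)).2 hreal (PP_real l hSp) (PP_real l hSm)
      hpq hc x hx
    rw [h1] at this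
    simp at this
  · right
    intro x hx h1
    have := greedy_step_aux x0 l _ _ _ (PP_monic l (S - rk u)).1 (PP_monic l (S + rk u)).1
      (PP_monic l (S - rk u)).2 (PP_monic l (S + rk u)).2 (fun t ht0 ht1 z hz =>
        hreal (1 - t) (by linarith) (by linarith) z (by
          rw [← hz]; push_cast; ring)) (PP_real l hSm) (PP_real l hSp)
      (fun x hx => by have := hpq x hx; linarith) (by linarith) x hx
    rw [h1] at this
    simp at this

theorem greedy_all {ι : Type*} [DecidableEq ι] (v : ι → n → ℂ) (x0 : ℝ) (l : List ι)
    (hl : l.Nodup) {S : Matrix n n ℂ} (hS : S.IsHermitian) (h : NR x0 (l.map v) S) :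
    ∃ ε : ι → ℝ, (∀ i, ε i = 1 ∨ ε i = -1) ∧
      NR x0 [] (S + (l.map fun i => ((ε i : ℝ) : ℂ) • rk (v i)).sum) := by
  induction l generalizing S with
  | nil => exact ⟨fun _ => 1, fun _ => Or.inl rfl, by simpa using h⟩
  | cons i l ih =>
    rw [List.nodup_cons] at hl
    have key : ∀ e : ℝ, (e = 1 ∨ e = -1) → NR x0 (l.map v) (S + (e : ℂ) • rk (v i)) →
        ∃ ε : ι → ℝ, (∀ i, ε i = 1 ∨ ε i = -1) ∧
      NR x0 [] (S + ((i :: l).map fun i => ((ε i : ℝ) : ℂ) • rk (v i)).sum) := by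
      intro e he hN
      obtain ⟨ε, h1, h2⟩ := ih hl.2 (hS.add (real_smul_herm (rk_herm (v i)) e)) hN
      refine ⟨Function.update ε i e, ?_, ?_⟩
      · intro j
        by_cases hj : j = i
        · subst hj; simpa using he
        · simpa [Function.update_of_ne hj] using h1 j
      · rw [List.map_cons, List.sum_cons, Function.update_self, ← add_assoc]
        have : (l.map fun j => ((Function.update ε i e j : ℝ) : ℂ) • rk (v j)) =
            (l.map fun j => ((ε j : ℝ) : ℂ) • rk (v j)) := by
          apply List.map_congr_left
          intro j hj
          have : j ≠ i := by rintro rfl; exact hl.1 hj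
          rw [Function.update_of_ne this]
        rw [this]
        exact h2
    rcases greedy_step x0 (l.map v) (v i) hS h with h | h
    · exact key 1 (Or.inl rfl) (by simpa using h)
    · exact key (-1) (Or.inr rfl) (by simpa [sub_eq_add_neg] using h)

theorem psd_of_NR {x0 : ℝ} {S : Matrix n n ℂ} (hS : S.IsHermitian)
    (h : ∀ x : ℝ, x0 ≤ x → ((x : ℂ) • (1 : Matrix n n ℂ) - S).det ≠ 0) :
    ((x0 : ℂ) • (1 : Matrix n n ℂ) - S).PosSemidef := by
  have hM : ((x0 : ℂ) • (1 : Matrix n n ℂ) - S).IsHermitian :=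
    (real_smul_herm isHermitian_one x0).sub hS
  rw [hM.posSemidef_iff_eigenvalues_nonneg]
  intro i
  by_contra hc
  simp only [Pi.zero_apply, not_le] at hc
  apply h (x0 - hM.eigenvalues i) (by linarith)
  rw [← exists_mulVec_eq_zero_iff]
  refine ⟨hM.eigenvectorBasis i, ?_, ?_⟩
  · intro h0
    have := hM.eigenvectorBasis.orthonormal.ne_zero i
    apply this
    ext j
    exact congrFun h0 j
  · have := hM.mulVec_eigenvectorBasis i
    rw [sub_mulVec, smul_mulVec, one_mulVec] at this ⊢
    rw [Complex.ofReal_sub, sub_smul, sub_right_comm, this]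
    ext j
    simp

theorem quad_sum {ι : Type*} (v : ι → n → ℂ) (ε : ι → ℝ) (l : List ι) (w : n → ℂ) :
    (star w ⬝ᵥ (l.map fun i => ((ε i : ℝ) : ℂ) • rk (v i)).sum *ᵥ w).re =
      (l.map fun i => ε i * ‖star (v i) ⬝ᵥ w‖ ^ 2).sum := by
  induction l with
  | nil => simp
  | cons u l ih =>
    rw [List.map_cons, List.sum_cons, add_mulVec, dotProduct_add, Complex.add_re,
      smul_mulVec, dotProduct_smul, quad_rk, smul_eq_mul, ← Complex.ofReal_mul, Complex.ofReal_re,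
      ih, List.map_cons, List.sum_cons]

theorem herm_sum {ι : Type*} (v : ι → n → ℂ) (ε : ι → ℝ) (l : List ι) :
    ((l.map fun i => ((ε i : ℝ) : ℂ) • rk (v i)).sum).IsHermitian := by
  induction l with
  | nil => simp
  | cons u l ih =>
    rw [List.map_cons, List.sum_cons]
    exact (real_smul_herm (rk_herm _) _).add ih

/-- Rank-one matrix discrepancy (Kyng, Luh, Song). -/
theorem discrepancy {ι : Type*} [DecidableEq ι] (v : ι → n → ℂ) (s : Finset ι) (σ2 x0 : ℝ)
    (hx0 : 0 < x0) (hσ : 8 * σ2 ≤ x0 ^ 2)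
    (h : ∀ w : n → ℂ, ∑ i ∈ s, nsq (v i) * ‖star (v i) ⬝ᵥ w‖ ^ 2 ≤ σ2 * nsq w) :
    ∃ ε : ι → ℝ, (∀ i, ε i = 1 ∨ ε i = -1) ∧ ∀ w : n → ℂ,
      |∑ i ∈ s, ε i * ‖star (v i) ⬝ᵥ w‖ ^ 2| ≤ x0 * nsq w := by
  have hNR : NR x0 (s.toList.map v) 0 := by
    intro x hx h0
    have hxp : 0 < x := by linarith
    have := H_pos (s.toList.map v) σ2 x hxp (by nlinarith) (fun w => by
      have := h w
      rw [← Finset.sum_map_toList] at this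
      rw [List.map_map]
      exact this)
    rw [PP_eval, sub_zero, add_zero] at h0
    rw [h0] at this
    simp at this
  obtain ⟨ε, h1, h2⟩ := greedy_all v x0 s.toList s.nodup_toList isHermitian_zero hNR
  refine ⟨ε, h1, fun w => ?_⟩
  rw [zero_add] at h2
  have hS := herm_sum v ε s.toList
  have hq := quad_sum v ε s.toList w
  rw [Finset.sum_map_toList s (fun i => ε i * ‖star (v i) ⬝ᵥ w‖ ^ 2)] at hq
  set S := (s.toList.map fun i => ((ε i : ℝ) : ℂ) • rk (v i)).sum
  have p1 := psd_of_NR (x0 := x0) hS (fun x hx h0 => h2 x hx (by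
    rw [PP_eval, H, h0, zero_mul]))
  have p2 := psd_of_NR (x0 := x0) hS.neg (fun x hx h0 => h2 x hx (by
    rw [PP_eval, H]
    rw [sub_neg_eq_add] at h0
    rw [h0, mul_zero]))
  have q1 := (Complex.nonneg_iff.mp (p1.dotProduct_mulVec_nonneg w)).1
  have q2 := (Complex.nonneg_iff.mp (p2.dotProduct_mulVec_nonneg w)).1
  simp only [sub_mulVec, dotProduct_sub, neg_mulVec, dotProduct_neg, smul_mulVec, one_mulVec,
    dotProduct_smul, star_dot_self, smul_eq_mul, ← Complex.ofReal_mul, Complex.sub_re,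
    Complex.neg_re, Complex.ofReal_re, hq] at q1 q2
  rw [abs_le]
  constructor <;> linarith

end KS

namespace KS
open Matrix
open scoped ComplexOrder
variable {n : Type*} [Fintype n] [DecidableEq n]

theorem halving {ι : Type*} [Fintype ι] [DecidableEq ι] (v : ι → n → ℂ) (δ : ℝ) (hδ : 0 < δ)
    (hv : ∀ i, nsq (v i) = δ) (hq : ∀ w, ∑ i, ‖star (v i) ⬝ᵥ w‖ ^ 2 = nsq w) (k : ℕ)
    (hk : 2 ^ k * δ ≤ 1 / 400) :
    ∃ S : Finset ι, ∀ w, |2 ^ k * ∑ i ∈ S, ‖star (v i) ⬝ᵥ w‖ ^ 2 - nsq w| ≤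
      10 * Real.sqrt (2 ^ k * δ) * nsq w := by
  induction k with
  | zero =>
    refine ⟨Finset.univ, fun w => ?_⟩
    rw [hq]
    have := nsq_nonneg w
    simp only [pow_zero, one_mul, sub_self, abs_zero]
    positivity
  | succ k ih =>
    have h2k : (0 : ℝ) < 2 ^ k := by positivity
    have hk1 : 2 ^ k * δ ≤ 1 / 400 := by
      rw [pow_succ] at hk
      have : 0 < 2 ^ k * δ := by positivity
      linarith
    obtain ⟨S, hS⟩ := ih hk1
    set r := Real.sqrt (2 ^ k * δ) with hr
    have hr0 : 0 < r := Real.sqrt_pos.mpr (by positivity)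
    have hr2 : r ^ 2 = 2 ^ k * δ := Real.sq_sqrt (by positivity)
    have hr20 : r ≤ 1 / 20 := by nlinarith
    have hup : ∀ w, ∑ i ∈ S, ‖star (v i) ⬝ᵥ w‖ ^ 2 ≤ 2 / 2 ^ k * nsq w := by
      intro w
      have h1 := (abs_le.mp (hS w)).2
      have h2 := nsq_nonneg w
      rw [div_mul_eq_mul_div, le_div_iff₀ h2k]
      nlinarith [mul_le_mul_of_nonneg_right hr20 h2]
    obtain ⟨ε, hε, hd⟩ := discrepancy v S (δ * (2 / 2 ^ k)) (4 * r / 2 ^ k) (by positivity)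
      (by
        rw [div_pow, mul_pow, hr2]
        apply le_of_eq
        field_simp
        norm_num) (fun w => by
        simp only [hv]
        rw [← Finset.mul_sum, mul_assoc]
        exact mul_le_mul_of_nonneg_left (hup w) hδ.le)
    refine ⟨S.filter (fun i => ε i = 1), fun w => ?_⟩
    have hsplit : ∑ i ∈ S.filter (fun i => ε i = 1), ‖star (v i) ⬝ᵥ w‖ ^ 2 =
        (∑ i ∈ S, ‖star (v i) ⬝ᵥ w‖ ^ 2 + ∑ i ∈ S, ε i * ‖star (v i) ⬝ᵥ w‖ ^ 2) / 2 := by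
      rw [Finset.sum_filter, ← Finset.sum_add_distrib, Finset.sum_div]
      apply Finset.sum_congr rfl
      intro i _
      rcases hε i with h | h
      · rw [if_pos h, h]; ring
      · rw [if_neg (by rw [h]; norm_num), h]; ring
    have hsq : Real.sqrt (2 ^ (k + 1) * δ) = Real.sqrt 2 * r := by
      rw [pow_succ, mul_comm (2 ^ k) (2:ℝ), mul_assoc, Real.sqrt_mul (by norm_num)]
    have h14 : (14 : ℝ) / 10 ≤ Real.sqrt 2 := Real.le_sqrt_of_sq_le (by norm_num)
    rw [hsplit, hsq]
    have hw := nsq_nonneg w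
    have e : 2 ^ (k + 1) * ((∑ i ∈ S, ‖star (v i) ⬝ᵥ w‖ ^ 2 +
        ∑ i ∈ S, ε i * ‖star (v i) ⬝ᵥ w‖ ^ 2) / 2) - nsq w =
        (2 ^ k * ∑ i ∈ S, ‖star (v i) ⬝ᵥ w‖ ^ 2 - nsq w) +
        2 ^ k * ∑ i ∈ S, ε i * ‖star (v i) ⬝ᵥ w‖ ^ 2 := by
      rw [pow_succ]; ring
    rw [e]
    have h5 : |2 ^ k * ∑ i ∈ S, ε i * ‖star (v i) ⬝ᵥ w‖ ^ 2| ≤ 4 * r * nsq w := by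
      rw [abs_mul, abs_of_pos h2k]
      calc _ ≤ 2 ^ k * (4 * r / 2 ^ k * nsq w) := mul_le_mul_of_nonneg_left (hd w) h2k.le
        _ = _ := by field_simp
    calc _ ≤ 10 * r * nsq w + 4 * r * nsq w := (abs_add_le _ _).trans (add_le_add (hS w) h5)
      _ ≤ _ := by nlinarith [mul_le_mul_of_nonneg_right h14 (mul_nonneg hr0.le hw)]

/-- combined selection -/
theorem selection {ι : Type*} [Fintype ι] [DecidableEq ι] [Nonempty n] [Nonempty ι]
    (v : ι → n → ℂ)
    (hv : ∀ i, nsq (v i) = Fintype.card n / Fintype.card ι)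
    (hv1 : ∀ i k, ‖v i k‖ ^ 2 = 1 / Fintype.card ι)
    (hq : ∀ w, ∑ i, ‖star (v i) ⬝ᵥ w‖ ^ 2 = nsq w) :
    ∃ S : Finset ι, (S.card : ℝ) ≤ 1200 * Fintype.card n ∧ ∀ w,
      1 / 3 * nsq w ≤ 1 / S.card * (Fintype.card ι * ∑ i ∈ S, ‖star (v i) ⬝ᵥ w‖ ^ 2) ∧
      1 / S.card * (Fintype.card ι * ∑ i ∈ S, ‖star (v i) ⬝ᵥ w‖ ^ 2) ≤ 3 * nsq w := by
  have hN : (0 : ℝ) < Fintype.card n := by exact_mod_cast Fintype.card_pos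
  have hM : (0 : ℝ) < Fintype.card ι := by exact_mod_cast Fintype.card_pos
  set N : ℝ := ((Fintype.card n : ℕ) : ℝ) with hNdef
  set M : ℝ := ((Fintype.card ι : ℕ) : ℝ) with hMdef
  obtain ⟨K, S, hK, hS⟩ : ∃ (K : ℕ) (S : Finset ι), M < 800 * N * 2 ^ K ∧
      ∀ w, |2 ^ K * ∑ i ∈ S, ‖star (v i) ⬝ᵥ w‖ ^ 2 - nsq w| ≤ 1 / 2 * nsq w := by
    by_cases hc : N / M ≤ 1 / 400
    · have hex : ∃ k : ℕ, 1 / 400 < 2 ^ (k + 1) * (N / M) := by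
        obtain ⟨k, hk⟩ := pow_unbounded_of_one_lt (1 / 400 / (N / M)) (one_lt_two (α := ℝ))
        refine ⟨k, ?_⟩
        rw [div_lt_iff₀ (by positivity)] at hk
        have : 0 < 2 ^ k * (N / M) := by positivity
        rw [pow_succ]; linarith
      classical
      have hK := Nat.find_spec hex
      have hKm : 2 ^ Nat.find hex * (N / M) ≤ 1 / 400 := by
        rcases Nat.eq_zero_or_pos (Nat.find hex) with h | h
        · rw [h]; simpa using hc
        · obtain ⟨j, hj⟩ := Nat.exists_eq_succ_of_ne_zero h.ne'
          have := Nat.find_min hex (m := j) (by omega)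
          rw [hj]
          exact not_lt.mp this
      obtain ⟨S, hS⟩ := halving v (N / M) (by positivity) hv hq _ hKm
      refine ⟨Nat.find hex, S, ?_, fun w => (hS w).trans ?_⟩
      · rw [pow_succ, mul_div_assoc', lt_div_iff₀ hM] at hK
        linarith
      · have : Real.sqrt (2 ^ Nat.find hex * (N / M)) ≤ 1 / 20 := by
          rw [Real.sqrt_le_left (by norm_num)]
          linarith
        have hw := nsq_nonneg w
        nlinarith [mul_le_mul_of_nonneg_right this hw]
    · refine ⟨0, Finset.univ, ?_, fun w => ?_⟩
      · rw [not_le, lt_div_iff₀ hM] at hc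
        simp; linarith
      · rw [hq]
        have hw := nsq_nonneg w
        simp; positivity
  have h2K : (0 : ℝ) < 2 ^ K := by positivity
  -- trace
  obtain ⟨k0⟩ := ‹Nonempty n›
  have htr := hS (Pi.single k0 1)
  have hn1 : nsq (Pi.single k0 (1 : ℂ) : n → ℂ) = 1 := by
    rw [nsq, Finset.sum_eq_single k0]
    · simp
    · intro b _ hb; simp [Pi.single_eq_of_ne hb]
    · simp
  have hs1 : ∑ i ∈ S, ‖star (v i) ⬝ᵥ (Pi.single k0 (1 : ℂ) : n → ℂ)‖ ^ 2 = S.card / M := by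
    rw [Finset.sum_congr rfl (g := fun _ => 1 / M)]
    · simp [div_eq_mul_inv]
    · intro i _
      rw [dotProduct_single, mul_one, Pi.star_apply, norm_star, hv1]
  rw [hn1, hs1, abs_le] at htr
  set m : ℝ := ((S.card : ℕ) : ℝ) with hmdef
  have hm1 : 1 / 2 * M ≤ 2 ^ K * m := by
    have : 1 / 2 ≤ 2 ^ K * m / M := by rw [mul_div_assoc]; linarith [htr.1]
    rwa [le_div_iff₀ hM] at this
  have hm2 : 2 ^ K * m ≤ 3 / 2 * M := by
    have : 2 ^ K * m / M ≤ 3 / 2 := by rw [mul_div_assoc]; linarith [htr.2]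
    rwa [div_le_iff₀ hM] at this
  have hm0 : 0 < m := by
    by_contra h
    have : 2 ^ K * m ≤ 0 := mul_nonpos_of_nonneg_of_nonpos h2K.le (not_lt.mp h)
    linarith
  refine ⟨S, ?_, fun w => ?_⟩
  · have : 2 ^ K * m ≤ 2 ^ K * (1200 * N) := by linarith
    exact le_of_mul_le_mul_left this h2K
  · have hw := nsq_nonneg w
    have h := abs_le.mp (hS w)
    set q := ∑ i ∈ S, ‖star (v i) ⬝ᵥ w‖ ^ 2
    rw [← hmdef, one_div_mul_eq_div m (M * q)]
    constructor
    · rw [le_div_iff₀ hm0]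
      have : 2 ^ K * (1 / 3 * nsq w * m) ≤ 2 ^ K * (M * q) := by
        nlinarith [mul_le_mul_of_nonneg_right hm2 hw, mul_le_mul_of_nonneg_left h.1 hM.le]
      exact le_of_mul_le_mul_left this h2K
    · rw [div_le_iff₀ hm0]
      have : 2 ^ K * (M * q) ≤ 2 ^ K * (3 * nsq w * m) := by
        nlinarith [mul_le_mul_of_nonneg_right hm1 hw, mul_le_mul_of_nonneg_left h.2 hM.le]
      exact le_of_mul_le_mul_left this h2K

end KS

namespace KS

/-- the exponential with frequency `l` -/
def ee {d : ℕ} (l : Fin d → ℤ) (x : Fin d → ℝ) : ℂ :=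
  Complex.exp (Complex.I * ∑ j, (l j : ℂ) * (x j : ℂ))

theorem ee_prod {d : ℕ} (l : Fin d → ℤ) (x : Fin d → ℝ) :
    ee l x = ∏ j, Complex.exp (Complex.I * (l j : ℂ) * (x j : ℂ)) := by
  rw [ee, Finset.mul_sum, Complex.exp_sum]
  simp only [mul_assoc]

theorem ee_conj {d : ℕ} (l : Fin d → ℤ) (x : Fin d → ℝ) :
    star (ee l x) = ee (-l) x := by
  rw [ee, ee, Complex.star_def, ← Complex.exp_conj]
  congr 1
  simp

theorem ee_mul {d : ℕ} (k l : Fin d → ℤ) (x : Fin d → ℝ) :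
    ee k x * ee l x = ee (k + l) x := by
  rw [ee, ee, ee, ← Complex.exp_add]
  congr 1
  simp [add_mul, Finset.sum_add_distrib, mul_add]

theorem ee_norm {d : ℕ} (l : Fin d → ℤ) (x : Fin d → ℝ) : ‖ee l x‖ = 1 := by
  rw [ee, mul_comm, show (∑ j, (l j : ℂ) * (x j : ℂ)) = ((∑ j, (l j : ℝ) * x j : ℝ) : ℂ) by
    push_cast; rfl]
  exact Complex.norm_exp_ofReal_mul_I _

theorem ee_cont {d : ℕ} (l : Fin d → ℤ) : Continuous (ee l) := by
  unfold ee
  fun_prop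

theorem expand {d : ℕ} (Q : Finset (Fin d → ℤ)) (c : (Fin d → ℤ) → ℂ) (x : Fin d → ℝ) :
    ((‖∑ k ∈ Q, c k * ee k x‖ ^ 2 : ℝ) : ℂ) =
      ∑ k ∈ Q, ∑ l ∈ Q, c k * star (c l) * ee (k - l) x := by
  rw [Complex.ofReal_pow, ← Complex.mul_conj', map_sum, Finset.sum_mul_sum]
  refine Finset.sum_congr rfl fun k _ => Finset.sum_congr rfl fun l _ => ?_
  rw [map_mul, ← Complex.star_def, ee_conj, sub_eq_add_neg, ← ee_mul]
  ring

theorem diag {d : ℕ} (Q : Finset (Fin d → ℤ)) (c : (Fin d → ℤ) → ℂ) (I : (Fin d → ℤ) → ℂ) (M : ℝ)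
    (hI : ∀ k ∈ Q, ∀ l ∈ Q, I (k - l) = if k = l then (M : ℂ) else 0) :
    ∑ k ∈ Q, ∑ l ∈ Q, c k * star (c l) * I (k - l) =
      ((M * ∑ k ∈ Q, ‖c k‖ ^ 2 : ℝ) : ℂ) := by
  push_cast
  rw [Finset.mul_sum]
  refine Finset.sum_congr rfl fun k hk => ?_
  rw [Finset.sum_eq_single k]
  · rw [hI k hk k hk, if_pos rfl, Complex.star_def, Complex.mul_conj']
    ring
  · intro l hl hkl
    rw [hI k hk l hl, if_neg hkl.symm, mul_zero]
  · exact fun h => absurd hk h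

theorem one_dim (l : ℤ) : ∫ x in Set.Ico 0 (2 * Real.pi), Complex.exp (Complex.I * l * (x : ℂ)) =
    if l = 0 then ((2 * Real.pi : ℝ) : ℂ) else 0 := by
  rw [integral_Ico_eq_integral_Ioc, ← intervalIntegral.integral_of_le (by positivity)]
  split_ifs with h
  · simp [h]
  · have hl : Complex.I * (l : ℂ) ≠ 0 := mul_ne_zero Complex.I_ne_zero (by exact_mod_cast h)
    rw [integral_exp_mul_complex hl]
    have : Complex.I * (l : ℂ) * ((2 * Real.pi : ℝ) : ℂ) = l * (2 * Real.pi * Complex.I) := by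
      push_cast; ring
    rw [this, Complex.exp_int_mul_two_pi_mul_I]
    simp

theorem ee_integral {d : ℕ} (l : Fin d → ℤ) :
    ∫ x, ee l x ∂(torusMeasure d) = if l = 0 then 1 else 0 := by
  rw [torusMeasure, integral_smul_measure, torusCell, volume_pi, Measure.restrict_pi_pi]
  simp only [ee_prod]
  rw [integral_fintype_prod_eq_prod (fun j (y : ℝ) => Complex.exp (Complex.I * (l j : ℂ) * (y : ℂ)))]
  simp only [one_dim]
  have hp : (0 : ℝ) < 2 * Real.pi := by positivity
  rw [ENNReal.toReal_inv, ENNReal.toReal_ofReal (by positivity)]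
  split_ifs with h
  · simp [h]
  · obtain ⟨j, hj⟩ := Function.ne_iff.mp h
    rw [Finset.prod_eq_zero (Finset.mem_univ j), smul_zero]
    simpa using hj

instance torus_fin (d : ℕ) : IsFiniteMeasure (torusMeasure d) := by
  constructor
  rw [torusMeasure, torusCell, Measure.smul_apply, Measure.restrict_apply_univ, volume_pi_pi]
  simp only [Real.volume_Ico, smul_eq_mul]
  apply ENNReal.mul_lt_top
  · rw [ENNReal.inv_lt_top, ENNReal.ofReal_pos]; positivity
  · exact ENNReal.prod_lt_top fun _ _ => ENNReal.ofReal_lt_top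

theorem ee_integrable {d : ℕ} (l : Fin d → ℤ) : Integrable (ee l) (torusMeasure d) :=
  Integrable.of_bound (ee_cont l).aestronglyMeasurable 1
    (Filter.Eventually.of_forall fun x => (ee_norm l x).le)

theorem parseval {d : ℕ} (Q : Finset (Fin d → ℤ)) (c : (Fin d → ℤ) → ℂ) (f : (Fin d → ℝ) → ℂ)
    (hf : ∀ x, f x = ∑ k ∈ Q, c k * ee k x) :
    torusLq d 2 f ^ 2 = ∑ k ∈ Q, ‖c k‖ ^ 2 := by
  have h1 : ∫ x, ‖f x‖ ^ (2 : ℝ) ∂(torusMeasure d) = ∑ k ∈ Q, ‖c k‖ ^ 2 := by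
    apply Complex.ofReal_injective
    rw [← integral_complex_ofReal]
    simp only [Real.rpow_two, hf, expand]
    rw [integral_finsetSum _ fun k _ => integrable_finsetSum _ fun l _ =>
      (ee_integrable (k - l)).const_mul _]
    have h2 : ∀ k ∈ Q, ∫ x, ∑ l ∈ Q, c k * star (c l) * ee (k - l) x ∂(torusMeasure d) =
        ∑ l ∈ Q, c k * star (c l) * ∫ x, ee (k - l) x ∂(torusMeasure d) := by
      intro k _
      rw [integral_finsetSum _ fun l _ => (ee_integrable (k - l)).const_mul _]
      simp only [integral_const_mul]
    rw [Finset.sum_congr rfl h2,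
      diag Q c (fun l => ∫ x, ee l x ∂(torusMeasure d)) 1 (fun k _ l _ => by
        rw [ee_integral]; simp [sub_eq_zero]), one_mul]
  rw [torusLq, h1, ← Real.sqrt_eq_rpow, Real.sq_sqrt (by positivity)]

/-- grid point -/
def gp {d : ℕ} (M : ℕ) (g : Fin d → Fin M) : Fin d → ℝ := fun j => 2 * Real.pi * (g j : ℕ) / M

theorem gp_mem {d M : ℕ} (g : Fin d → Fin M) : gp M g ∈ torusCell d := by
  intro j _
  have h := (g j).isLt
  have hM : (0 : ℝ) < M := by exact_mod_cast (Nat.zero_le _).trans_lt h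
  have h' : ((g j : ℕ) : ℝ) < M := by exact_mod_cast h
  refine ⟨by unfold gp; positivity, ?_⟩
  unfold gp
  rw [div_lt_iff₀ hM]
  exact mul_lt_mul_of_pos_left h' (by positivity)

theorem geom (M : ℕ) (hM : 0 < M) (l : ℤ) (hl : |l| < M) :
    ∑ a : Fin M, Complex.exp (Complex.I * (l : ℂ) * ((2 * Real.pi * (a : ℕ) / M : ℝ) : ℂ)) =
      if l = 0 then (M : ℂ) else 0 := by
  have hMc : (M : ℂ) ≠ 0 := by exact_mod_cast hM.ne'
  split_ifs with h
  · simp [h]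
  · set ζ := Complex.exp (l / M * (2 * Real.pi * Complex.I)) with hζ
    have e : ∀ a : ℕ, Complex.exp (Complex.I * (l : ℂ) * ((2 * Real.pi * (a : ℕ) / M : ℝ) : ℂ)) =
        ζ ^ a := by
      intro a
      rw [hζ, ← Complex.exp_nat_mul]
      congr 1
      push_cast
      ring
    simp only [e]
    rw [Fin.sum_univ_eq_sum_range (fun a => ζ ^ a) M]
    have h1 : ζ ≠ 1 := by
      rw [hζ, Ne, Complex.exp_eq_one_iff]
      rintro ⟨m, hm⟩
      have h2 := mul_right_cancel₀ Complex.two_pi_I_ne_zero hm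
      rw [div_eq_iff hMc] at h2
      have h3 : l = m * M := by exact_mod_cast h2
      have h4 : m ≠ 0 := by rintro rfl; simp at h3; exact h h3
      rw [h3, abs_mul] at hl
      have h5 : 1 ≤ |m| := Int.one_le_abs h4
      have h6 : |(M : ℤ)| = M := abs_of_nonneg (by positivity)
      rw [h6] at hl
      nlinarith
    have h2 : ζ ^ M = 1 := by
      rw [hζ, ← Complex.exp_nat_mul, ← Complex.exp_int_mul_two_pi_mul_I l]
      congr 1
      field_simp
    rw [geom_sum_eq h1, h2, sub_self, zero_div]

theorem ee_grid {d : ℕ} (M : ℕ) (hM : 0 < M) (l : Fin d → ℤ) (hl : ∀ j, |l j| < M) :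
    ∑ g : Fin d → Fin M, ee l (gp M g) = if l = 0 then (((M : ℝ) ^ d : ℝ) : ℂ) else 0 := by
  simp only [ee_prod, gp]
  have := Finset.prod_univ_sum (fun _ : Fin d => (Finset.univ : Finset (Fin M)))
    (fun j a => Complex.exp (Complex.I * (l j : ℂ) * ((2 * Real.pi * (a : ℕ) / M : ℝ) : ℂ)))
  rw [Fintype.piFinset_univ] at this
  rw [← this]
  simp only [geom M hM _ (hl _)]
  split_ifs with h
  · simp [h]
  · obtain ⟨j, hj⟩ := Function.ne_iff.mp h
    rw [Finset.prod_eq_zero (Finset.mem_univ j)]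
    exact if_neg hj

theorem grid_parseval {d : ℕ} (Q : Finset (Fin d → ℤ)) (M : ℕ) (hM : 0 < M)
    (hQ : ∀ k ∈ Q, ∀ l ∈ Q, ∀ j, |(k - l) j| < M) (c : (Fin d → ℤ) → ℂ) :
    ∑ g : Fin d → Fin M, ‖∑ k ∈ Q, c k * ee k (gp M g)‖ ^ 2 =
      (M : ℝ) ^ d * ∑ k ∈ Q, ‖c k‖ ^ 2 := by
  apply Complex.ofReal_injective
  rw [Complex.ofReal_sum]
  simp only [expand]
  rw [Finset.sum_comm]
  have : ∀ k ∈ Q, ∑ g : Fin d → Fin M, ∑ l ∈ Q, c k * star (c l) * ee (k - l) (gp M g) =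
      ∑ l ∈ Q, c k * star (c l) * ∑ g : Fin d → Fin M, ee (k - l) (gp M g) := by
    intro k _
    rw [Finset.sum_comm]
    simp only [Finset.mul_sum]
  rw [Finset.sum_congr rfl this,
    diag Q c (fun l => ∑ g : Fin d → Fin M, ee l (gp M g)) ((M : ℝ) ^ d) (fun k hk l hl => by
      rw [ee_grid M hM _ (hQ k hk l hl)]; simp only [sub_eq_zero])]

theorem exists_M {d : ℕ} (Q : Finset (Fin d → ℤ)) :
    ∃ M : ℕ, 0 < M ∧ ∀ k ∈ Q, ∀ l ∈ Q, ∀ j, |(k - l) j| < M := by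
  refine ⟨(∑ k ∈ Q, ∑ l ∈ Q, ∑ j, ((k - l) j).natAbs) + 1, Nat.succ_pos _, ?_⟩
  intro k hk l hl j
  have h1 : ((k - l) j).natAbs ≤ ∑ j, ((k - l) j).natAbs :=
    Finset.single_le_sum (f := fun j => ((k - l) j).natAbs) (fun _ _ => Nat.zero_le _)
      (Finset.mem_univ j)
  have h2 : ∑ j, ((k - l) j).natAbs ≤ ∑ l ∈ Q, ∑ j, ((k - l) j).natAbs :=
    Finset.single_le_sum (f := fun l => ∑ j, ((k - l) j).natAbs) (fun _ _ => Nat.zero_le _) hl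
  have h3 : ∑ l ∈ Q, ∑ j, ((k - l) j).natAbs ≤ ∑ k ∈ Q, ∑ l ∈ Q, ∑ j, ((k - l) j).natAbs :=
    Finset.single_le_sum (f := fun k => ∑ l ∈ Q, ∑ j, ((k - l) j).natAbs)
      (fun _ _ => Nat.zero_le _) hk
  have h4 : ((k - l) j).natAbs < (∑ k ∈ Q, ∑ l ∈ Q, ∑ j, ((k - l) j).natAbs) + 1 := by omega
  rw [Int.abs_eq_natAbs]
  exact_mod_cast h4

end KS

/-- There exist positive absolute constants `C1, C2, C3` such that for every
`d` and every finite `Q ⊂ ℤ^d` there are `m ≤ C1·|Q|` points of the torus at which the `L_2`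
norm of every trigonometric polynomial with frequencies in `Q` is discretized. -/
theorem stmt_0 :
    ∃ C1 C2 C3 : ℝ, 0 < C1 ∧ 0 < C2 ∧ 0 < C3 ∧
      ∀ (d : ℕ) (Q : Finset (Fin d → ℤ)),
        ∃ (m : ℕ) (ξ : Fin m → (Fin d → ℝ)),
          (m : ℝ) ≤ C1 * Q.card ∧ (∀ j, ξ j ∈ torusCell d) ∧
          ∀ f : (Fin d → ℝ) → ℂ,
            (∃ c : (Fin d → ℤ) → ℂ, ∀ x, f x = ∑ k ∈ Q,
                c k * Complex.exp (Complex.I * ∑ j, (k j : ℂ) * (x j : ℂ))) →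
            C2 * torusLq d 2 f ^ 2 ≤ (1 / m : ℝ) * ∑ j, ‖f (ξ j)‖ ^ 2 ∧
            (1 / m : ℝ) * ∑ j, ‖f (ξ j)‖ ^ 2 ≤ C3 * torusLq d 2 f ^ 2 := by
  refine ⟨1200, 1 / 3, 3, by norm_num, by norm_num, by norm_num, fun d Q => ?_⟩
  rcases Q.eq_empty_or_nonempty with rfl | hQ
  · refine ⟨0, Fin.elim0, by simp, fun j => j.elim0, ?_⟩
    rintro f ⟨c, hf⟩
    have := KS.parseval ∅ c f hf
    rw [this]
    simp
  obtain ⟨M, hM, hMQ⟩ := KS.exists_M Q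
  have : Nonempty (Fin M) := ⟨⟨0, hM⟩⟩
  have : Nonempty Q := hQ.to_subtype
  have hMr : (0 : ℝ) < (M : ℝ) ^ d := by positivity
  set s := Real.sqrt ((M : ℝ) ^ d) with hs
  have hs0 : 0 < s := Real.sqrt_pos.mpr hMr
  have hs2 : s ^ 2 = (M : ℝ) ^ d := Real.sq_sqrt hMr.le
  have hcard : ((Fintype.card (Fin d → Fin M) : ℕ) : ℝ) = (M : ℝ) ^ d := by simp
  have hcQ : ((Fintype.card Q : ℕ) : ℝ) = Q.card := by simp
  let v : (Fin d → Fin M) → Q → ℂ := fun g k => star (KS.ee (k : Fin d → ℤ) (KS.gp M g)) / (s : ℂ)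
  have hv1 : ∀ i k, ‖v i k‖ ^ 2 = 1 / ((Fintype.card (Fin d → Fin M) : ℕ) : ℝ) := by
    intro i k
    rw [hcard]
    simp only [v]
    rw [norm_div, norm_star, KS.ee_norm, Complex.norm_real, Real.norm_of_nonneg hs0.le, div_pow, hs2,
      one_pow]
  have hvw : ∀ (w : Q → ℂ) (c : (Fin d → ℤ) → ℂ) (_ : ∀ k : Q, c k = w k) g,
      ‖∑ k ∈ Q, c k * KS.ee k (KS.gp M g)‖ ^ 2 =
        ((Fintype.card (Fin d → Fin M) : ℕ) : ℝ) * ‖star (v g) ⬝ᵥ w‖ ^ 2 := by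
    intro w c hc g
    have : star (v g) ⬝ᵥ w = (∑ k ∈ Q, c k * KS.ee k (KS.gp M g)) / (s : ℂ) := by
      rw [← Finset.sum_coe_sort, dotProduct, Finset.sum_div]
      refine Finset.sum_congr rfl fun k _ => ?_
      simp only [v, Pi.star_apply, star_div₀, star_star, hc]
      rw [Complex.star_def, Complex.conj_ofReal]
      ring
    rw [this, norm_div, Complex.norm_real, Real.norm_of_nonneg hs0.le, div_pow, hs2, hcard]
    field_simp
  have hnsq : ∀ (w : Q → ℂ) (c : (Fin d → ℤ) → ℂ) (_ : ∀ k : Q, c k = w k),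
      ∑ k ∈ Q, ‖c k‖ ^ 2 = KS.nsq w := by
    intro w c hc
    rw [← Finset.sum_coe_sort, KS.nsq]
    simp only [hc]
  obtain ⟨S, hS1, hS2⟩ := KS.selection v (fun i => by
      rw [KS.nsq]
      simp only [hv1]
      rw [Finset.sum_const, Finset.card_univ, nsmul_eq_mul, mul_one_div]) hv1 (fun w => by
      let c : (Fin d → ℤ) → ℂ := fun k => if h : k ∈ Q then w ⟨k, h⟩ else 0
      have hc : ∀ k : Q, c k = w k := fun k => by simp [c]
      have h := KS.grid_parseval Q M hM hMQ c
      simp only [hvw w c hc, hnsq w c hc] at h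
      rw [← Finset.mul_sum, hcard] at h
      exact mul_left_cancel₀ hMr.ne' h)
  refine ⟨S.card, fun j => KS.gp M (S.equivFin.symm j), by rw [← hcQ]; exact hS1,
    fun j => KS.gp_mem _, ?_⟩
  rintro f ⟨c, hf⟩
  have hp := KS.parseval Q c f hf
  have hsum : ∑ j, ‖f (KS.gp M (S.equivFin.symm j))‖ ^ 2 =
      ((Fintype.card (Fin d → Fin M) : ℕ) : ℝ) * ∑ i ∈ S, ‖star (v i) ⬝ᵥ (fun k : Q => c k)‖ ^ 2 := by
    rw [Equiv.sum_comp S.equivFin.symm (fun g : S => ‖f (KS.gp M (g : Fin d → Fin M))‖ ^ 2),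
      Finset.sum_coe_sort S (fun g => ‖f (KS.gp M g)‖ ^ 2), Finset.mul_sum]
    refine Finset.sum_congr rfl fun g _ => ?_
    rw [hf]
    exact hvw (fun k : Q => c k) c (fun _ => rfl) g
  rw [hp, hsum, hnsq (fun k : Q => c k) c (fun _ => rfl)]
  exact hS2 _
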